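/- For every integer k ≥ 5, the number 1/⌊k/2⌋ is a limit point of the set S_k^1. -/

import Mathlib

open Filter Topology FirstOrder

namespace RandomGraphSpectra

/-- The quantifier depth of a first-order (bounded) formula. -/
def qDepth {L : FirstOrder.Language} {α : Type*} :
    ∀ {n : ℕ}, L.BoundedFormula α n → ℕ
  | _, .falsum => 0
  | _, .equal _ _ => 0
  | _, .rel _ _ => 0
  | _, .imp f g => max (qDepth f) (qDepth g)
  | _, .all f => qDepth f + 1

/-- A simple graph satisfies a first-order sentence in the language of graphs. -/
def GraphSat {V : Type*} (G : SimpleGraph V) (φ : FirstOrder.Language.graph.Sentence) : Prop :=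
  @FirstOrder.Language.Sentence.Realize FirstOrder.Language.graph V G.structure φ

/-- The number of edges of a simple graph. -/
noncomputable def edgeCount {V : Type*} (G : SimpleGraph V) : ℕ := Nat.card G.edgeSet

/-- The probability that `G(n,p)` equals a fixed graph `G` on `{1,…,n}`. -/
noncomputable def weight (n : ℕ) (p : ℝ) (G : SimpleGraph (Fin n)) : ℝ :=
  p ^ edgeCount G * (1 - p) ^ (n.choose 2 - edgeCount G)

open Classical in
/-- The probability that the Erdős–Rényi random graph `G(n,p)` satisfies a predicate `P`. -/
noncomputable def probPred (n : ℕ) (p : ℝ) (P : SimpleGraph (Fin n) → Prop) : ℝ :=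
  ∑ᶠ G : SimpleGraph (Fin n), if P G then weight n p G else 0

/-- The probability that `G(n,p)` satisfies a first-order sentence. -/
noncomputable def probSat (n : ℕ) (p : ℝ) (φ : FirstOrder.Language.graph.Sentence) : ℝ :=
  probPred n p (fun G => GraphSat G φ)

open Classical in
/-- The probability that the pair of independent random graphs `G(n,p), G(m,q)`
satisfies a predicate `P`. -/
noncomputable def probPred2 (n m : ℕ) (p q : ℝ)
    (P : SimpleGraph (Fin n) → SimpleGraph (Fin m) → Prop) : ℝ :=
  ∑ᶠ G : SimpleGraph (Fin n), ∑ᶠ H : SimpleGraph (Fin m),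
    if P G H then weight n p G * weight m q H else 0

/-- The spectrum `S_k^1`: the set of `α ∈ (0,1)` such that for some first-order sentence `φ`
of quantifier depth at most `k`, with `p(n) = n^{-α}`, the probability that `G(n,p(n)) ⊨ φ`
does not tend to `0` and does not tend to `1`. -/
def S1 (k : ℕ) : Set ℝ :=
  {α | α ∈ Set.Ioo (0 : ℝ) 1 ∧ ∃ φ : FirstOrder.Language.graph.Sentence, qDepth φ ≤ k ∧
    ¬(Tendsto (fun n : ℕ => probSat n ((n : ℝ) ^ (-α)) φ) atTop (nhds 0) ∨
      Tendsto (fun n : ℕ => probSat n ((n : ℝ) ^ (-α)) φ) atTop (nhds 1))}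

/-- The spectrum `S_k^2`. -/
def S2 (k : ℕ) : Set ℝ :=
  {α | α ∈ Set.Ioo (0 : ℝ) 1 ∧ ∃ φ : FirstOrder.Language.graph.Sentence, qDepth φ ≤ k ∧
    ¬∃ δ : ℝ, (δ = 0 ∨ δ = 1) ∧ ∃ ε : ℝ, 0 < ε ∧ ∀ p : ℕ → ℝ,
      (∀ n : ℕ, 1 ≤ n → (n : ℝ) ^ (-α - ε) < p n ∧ p n < (n : ℝ) ^ (-α + ε)) →
      Tendsto (fun n : ℕ => probSat n (p n) φ) atTop (nhds δ)}

/-- `G(n, p(n))` obeys the zero-one `k`-law. -/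
def ZeroOneKLaw (k : ℕ) (p : ℕ → ℝ) : Prop :=
  ∀ φ : FirstOrder.Language.graph.Sentence, qDepth φ ≤ k →
    Tendsto (fun n : ℕ => probSat n (p n) φ) atTop (nhds 0) ∨
    Tendsto (fun n : ℕ => probSat n (p n) φ) atTop (nhds 1)

/-- The density `ρ(G) = e(G)/v(G)` of a graph. -/
noncomputable def density {V : Type*} (G : SimpleGraph V) : ℝ :=
  (Nat.card G.edgeSet : ℝ) / (Nat.card V : ℝ)

/-- A graph is strictly balanced if every proper subgraph with at least one vertex has
strictly smaller density. -/
def StrictlyBalanced {V : Type*} (G : SimpleGraph V) : Prop :=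
  ∀ H : G.Subgraph, H ≠ ⊤ → H.verts.Nonempty → density H.coe < density G

/-- `ρ^max(G)`: the maximum density of a subgraph of `G` with at least one vertex. -/
noncomputable def maxDensity {V : Type*} (G : SimpleGraph V) : ℝ :=
  sSup {x : ℝ | ∃ H : G.Subgraph, H.verts.Nonempty ∧ x = density H.coe}

/-- The relative density `ρ(K,H) = e(K,H)/v(K,H)` of a pair of nested subgraphs. -/
noncomputable def pairDensity {V : Type*} {G : SimpleGraph V} (K H : G.Subgraph) : ℝ :=
  ((Nat.card K.edgeSet : ℝ) - (Nat.card H.edgeSet : ℝ)) /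
    ((Nat.card K.verts : ℝ) - (Nat.card H.verts : ℝ))

/-- `ρ^max(G,H)` where the ambient graph `G` corresponds to the top subgraph. -/
noncomputable def maxPairDensity {V : Type*} {G : SimpleGraph V} (H : G.Subgraph) : ℝ :=
  sSup {x : ℝ | ∃ K : G.Subgraph, H < K ∧ x = pairDensity K H}

/-- `f_α(K,H) = v(K,H) - α·e(K,H)`. -/
noncomputable def fAlpha (α : ℝ) {V : Type*} {G : SimpleGraph V} (K H : G.Subgraph) : ℝ :=
  ((Nat.card K.verts : ℝ) - (Nat.card H.verts : ℝ)) -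
    α * ((Nat.card K.edgeSet : ℝ) - (Nat.card H.edgeSet : ℝ))

/-- The pair `(G,H)` is `α`-safe: `f_α(S,H) > 0` for every `S` with `H ⊂ S ⊆ G`. -/
def AlphaSafe (α : ℝ) {V : Type*} (G : SimpleGraph V) (H : G.Subgraph) : Prop :=
  ∀ S : G.Subgraph, H < S → 0 < fAlpha α S H

/-- The pair `(G,H)` is strictly balanced: `ρ(G,H) > ρ(K,H)` for every `H ⊂ K ⊂ G`. -/
def StrictlyBalancedPair {V : Type*} (G : SimpleGraph V) (H : G.Subgraph) : Prop :=
  ∀ K : G.Subgraph, H < K → K ≠ ⊤ → pairDensity K H < pairDensity (⊤ : G.Subgraph) H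

/-- The set `E(K) \ (E(H) ∪ E(K∖H))` is non-empty: `K` has an edge, not an edge of `H`,
with at least one endpoint in `V(H)`. -/
def TouchesRoots {V : Type*} {G : SimpleGraph V} (H K : G.Subgraph) : Prop :=
  ∃ u v : V, K.Adj u v ∧ ¬H.Adj u v ∧ (u ∈ H.verts ∨ v ∈ H.verts)

/-- `e^min(G,H)` (`G` being the top subgraph). -/
noncomputable def eMin {V : Type*} {G : SimpleGraph V} (H : G.Subgraph) : ℕ :=
  sInf {e : ℕ | ∃ K : G.Subgraph, H < K ∧ TouchesRoots H K ∧
    pairDensity K H = maxPairDensity H ∧ e = Nat.card K.edgeSet - Nat.card H.edgeSet}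

/-- `f` realizes a `(G,(r 0,…,r (m-1)))`-extension of the tuple `x` in `Γ`: an injective copy
of the vertex set of `G` sending the roots to `x` and containing all edges of `E(G)∖E(H)`
as edges outside the root-induced subgraph. -/
def IsExtension {W V : Type*} (Gp : SimpleGraph W) (H : Gp.Subgraph) {m : ℕ}
    (r : Fin m → W) (Γ : SimpleGraph V) (x : Fin m → V) (f : W → V) : Prop :=
  Function.Injective f ∧ (∀ j : Fin m, f (r j) = x j) ∧
    ∀ u v : W, Gp.Adj u v → ¬H.Adj u v →
      Γ.Adj (f u) (f v) ∧ ¬(u ∈ H.verts ∧ v ∈ H.verts)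

/-- Strict extension: the implication above is an equivalence. -/
def IsStrictExtension {W V : Type*} (Gp : SimpleGraph W) (H : Gp.Subgraph) {m : ℕ}
    (r : Fin m → W) (Γ : SimpleGraph V) (x : Fin m → V) (f : W → V) : Prop :=
  Function.Injective f ∧ (∀ j : Fin m, f (r j) = x j) ∧
    ∀ u v : W, (Gp.Adj u v ∧ ¬H.Adj u v) ↔
      (Γ.Adj (f u) (f v) ∧ ¬(u ∈ H.verts ∧ v ∈ H.verts))

/-- The pair of subgraphs of `Γ` with vertex sets `B ⊆ A` is `(K,T)`-maximal in `Γ`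
(where `T ⊂ K` has roots enumerated by `s`). -/
def PairMaximal {U V : Type*} (Kp : SimpleGraph U) (T : Kp.Subgraph) {t : ℕ}
    (s : Fin t → U) (Γ : SimpleGraph V) (A B : Set V) : Prop :=
  ∀ tup : Fin t → V, Function.Injective tup → (∀ i, tup i ∈ A) → (∃ i, tup i ∉ B) →
    ¬∃ f : U → V, IsStrictExtension Kp T s Γ tup f ∧
      (∀ u : U, f u ∈ A → f u ∈ Set.range tup) ∧
      (∀ u : U, f u ∉ Set.range tup → ∀ a ∈ A, a ∉ Set.range tup → ¬Γ.Adj (f u) a)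

/-- The subgraph of `Γ` with vertex set `A` is `(K,T)`-maximal in `Γ`. -/
def GraphMaximal {U V : Type*} (Kp : SimpleGraph U) (T : Kp.Subgraph) {t : ℕ}
    (s : Fin t → U) (Γ : SimpleGraph V) (A : Set V) : Prop :=
  ∀ tup : Fin t → V, Function.Injective tup → (∀ i, tup i ∈ A) →
    ¬∃ f : U → V, IsStrictExtension Kp T s Γ tup f ∧
      (∀ u : U, f u ∈ A → f u ∈ Set.range tup) ∧
      (∀ u : U, f u ∉ Set.range tup → ∀ a ∈ A, a ∉ Set.range tup → ¬Γ.Adj (f u) a)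

/-- `Γ` contains a copy of `Gp`. -/
def ContainsCopy {W V : Type*} (Gp : SimpleGraph W) (Γ : SimpleGraph V) : Prop :=
  ∃ f : W → V, Function.Injective f ∧ ∀ u v : W, Gp.Adj u v → Γ.Adj (f u) (f v)

/-- The number of copies of `Gp` in `Γ`: subgraphs of `Γ` isomorphic to `Gp`. -/
noncomputable def numCopies {W V : Type*} (Gp : SimpleGraph W) (Γ : SimpleGraph V) : ℕ :=
  Nat.card {H : Γ.Subgraph // Nonempty (Gp ≃g H.coe)}

/-- The matched tuples of chosen vertices induce a partial isomorphism. -/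
def PartialIso {V W : Type*} (G : SimpleGraph V) (H : SimpleGraph W)
    (xs : List V) (ys : List W) : Prop :=
  ∃ h : xs.length = ys.length,
    ∀ j k : Fin xs.length,
      (xs.get j = xs.get k ↔ ys.get (Fin.cast h j) = ys.get (Fin.cast h k)) ∧
      (G.Adj (xs.get j) (xs.get k) ↔ H.Adj (ys.get (Fin.cast h j)) (ys.get (Fin.cast h k)))

/-- Duplicator has a winning strategy in the remaining `i` rounds of the Ehrenfeucht game
on `(G,H)` from the position given by the already chosen vertices `xs`, `ys`. -/
def DuplicatorWinsFrom {V W : Type*} (G : SimpleGraph V) (H : SimpleGraph W) :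
    ℕ → List V → List W → Prop
  | 0, xs, ys => PartialIso G H xs ys
  | (i + 1), xs, ys =>
      (∀ x : V, ∃ y : W, DuplicatorWinsFrom G H i (x :: xs) (y :: ys)) ∧
      (∀ y : W, ∃ x : V, DuplicatorWinsFrom G H i (x :: xs) (y :: ys))

/-- Duplicator has a winning strategy in the Ehrenfeucht game `EHR(G,H,i)`. -/
def DuplicatorWins {V W : Type*} (G : SimpleGraph V) (H : SimpleGraph W) (i : ℕ) : Prop :=
  DuplicatorWinsFrom G H i [] []

end RandomGraphSpectra

namespace RandomGraphSpectra

/-- The class `𝒮` of graphs from Section "Properties which imply the existence of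
Duplicator's winning strategy" (properties 1)–3)). -/
def GoodGraph (k b : ℕ) (α : ℝ) {V : Type*} (Γ : SimpleGraph V) : Prop :=
  -- 1) no strictly balanced subgraph with at most `2^{2k}·b` vertices and density `> 1/α`
  (∀ A : Γ.Subgraph, Nat.card A.verts ≤ 2 ^ (2 * k) * b → StrictlyBalanced A.coe →
      density A.coe ≤ 1 / α) ∧
  -- 2) strict extensions of α-safe pairs which are `(K₁,K₂)`-maximal
  (∀ (l h : ℕ) (H₁ : SimpleGraph (Fin l)) (H₂ : H₁.Subgraph) (r : Fin h → Fin l),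
      Function.Injective r → Set.range r = H₂.verts →
      l ≤ 2 ^ (2 * k) * b + k * 2 ^ k → AlphaSafe α H₁ H₂ →
      ∀ x : Fin h → V, Function.Injective x →
        ∃ f : Fin l → V, IsStrictExtension H₁ H₂ r Γ x f ∧
          ∀ (u t : ℕ) (K₁ : SimpleGraph (Fin u)) (K₂ : K₁.Subgraph) (s : Fin t → Fin u),
            Function.Injective s → Set.range s = K₂.verts →
            u ≤ 2 ^ k → Nat.card K₂.verts ≤ 2 → fAlpha α (⊤ : K₁.Subgraph) K₂ < 0 →
            PairMaximal K₁ K₂ s Γ (Set.range f) (Set.range x)) ∧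
  -- 3) maximal copies of sparse strictly balanced graphs
  (∀ (w : ℕ) (Hp : SimpleGraph (Fin w)), w ≤ 2 ^ (2 * k) * b → StrictlyBalanced Hp →
      density Hp < 1 / α →
      ∃ f : Fin w → V, Function.Injective f ∧
        (∀ u v : Fin w, Hp.Adj u v → Γ.Adj (f u) (f v)) ∧
        ∀ (u t : ℕ) (K₁ : SimpleGraph (Fin u)) (K₂ : K₁.Subgraph) (s : Fin t → Fin u),
          Function.Injective s → Set.range s = K₂.verts →
          u ≤ 2 ^ k → Nat.card K₂.verts ≤ 2 → fAlpha α (⊤ : K₁.Subgraph) K₂ < 0 →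
          GraphMaximal K₁ K₂ s Γ (Set.range f))

end RandomGraphSpectra

namespace RandomGraphSpectra

/-! ### Part 1: first-order definability -/

/-- `P` is definable by a formula with `n` free variables and quantifier depth at most `d`. -/
def Dfn (d n : ℕ) (P : ∀ N : ℕ, SimpleGraph (Fin N) → (Fin n → Fin N) → Prop) : Prop :=
  ∃ φ : FirstOrder.Language.graph.BoundedFormula Empty n, qDepth φ ≤ d ∧
    ∀ (N : ℕ) (G : SimpleGraph (Fin N)) (v : Fin n → Fin N),
      (@FirstOrder.Language.BoundedFormula.Realize _ _ G.structure _ _ φ default v ↔ P N G v)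

lemma Dfn.congr {d n : ℕ} {P P' : ∀ N : ℕ, SimpleGraph (Fin N) → (Fin n → Fin N) → Prop}
    (h : Dfn d n P) (hP : ∀ N G v, P N G v ↔ P' N G v) : Dfn d n P' := by
  obtain ⟨φ, h1, h2⟩ := h
  exact ⟨φ, h1, fun N G v => (h2 N G v).trans (hP N G v)⟩

lemma Dfn.mono {d d' n : ℕ} {P : ∀ N : ℕ, SimpleGraph (Fin N) → (Fin n → Fin N) → Prop}
    (h : Dfn d n P) (hd : d ≤ d') : Dfn d' n P := by
  obtain ⟨φ, h1, h2⟩ := h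
  exact ⟨φ, h1.trans hd, h2⟩

lemma Dfn.imp {d n : ℕ} {P P' : ∀ N : ℕ, SimpleGraph (Fin N) → (Fin n → Fin N) → Prop}
    (h : Dfn d n P) (h' : Dfn d n P') : Dfn d n (fun N G v => P N G v → P' N G v) := by
  obtain ⟨φ, h1, h2⟩ := h
  obtain ⟨ψ, h3, h4⟩ := h'
  refine ⟨φ.imp ψ, by simp [qDepth, h1, h3], fun N G v => ?_⟩
  exact imp_congr (h2 N G v) (h4 N G v)

lemma Dfn.fls {d n : ℕ} : Dfn d n (fun _ _ _ => False) :=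
  ⟨.falsum, by simp [qDepth], fun N G v => Iff.rfl⟩

lemma Dfn.not {d n : ℕ} {P : ∀ N : ℕ, SimpleGraph (Fin N) → (Fin n → Fin N) → Prop}
    (h : Dfn d n P) : Dfn d n (fun N G v => ¬ P N G v) :=
  (h.imp Dfn.fls).congr fun N G v => Iff.rfl

lemma Dfn.tru {d n : ℕ} : Dfn d n (fun _ _ _ => True) :=
  (Dfn.fls.not).congr fun N G v => by simp

lemma Dfn.and {d n : ℕ} {P P' : ∀ N : ℕ, SimpleGraph (Fin N) → (Fin n → Fin N) → Prop}
    (h : Dfn d n P) (h' : Dfn d n P') : Dfn d n (fun N G v => P N G v ∧ P' N G v) :=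
  ((h.imp h'.not).not).congr fun N G v => by tauto

lemma Dfn.guard {d n : ℕ} (q : Prop)
    {P : ∀ N : ℕ, SimpleGraph (Fin N) → (Fin n → Fin N) → Prop}
    (h : q → Dfn d n P) : Dfn d n (fun N G v => q → P N G v) := by
  by_cases hq : q
  · exact (h hq).congr fun N G v => by simp [hq]
  · exact Dfn.tru.congr fun N G v => by simp [hq]

lemma Dfn.forallFin {d n t : ℕ}
    {P : Fin t → ∀ N : ℕ, SimpleGraph (Fin N) → (Fin n → Fin N) → Prop}
    (h : ∀ i, Dfn d n (P i)) : Dfn d n (fun N G v => ∀ i, P i N G v) := by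
  induction t with
  | zero => exact Dfn.tru.congr fun N G v => by simp
  | succ t ih =>
    exact ((h 0).and (ih fun i => h i.succ)).congr fun N G v => by
      rw [Fin.forall_fin_succ]

lemma Dfn.adj {d n : ℕ} (i l : Fin n) : Dfn d n (fun _ G v => G.Adj (v i) (v l)) := by
  refine ⟨FirstOrder.Language.Relations.boundedFormula₂ FirstOrder.Language.adj
    (FirstOrder.Language.Term.var (Sum.inr i)) (FirstOrder.Language.Term.var (Sum.inr l)),
    by simp [FirstOrder.Language.Relations.boundedFormula₂,
      FirstOrder.Language.Relations.boundedFormula, qDepth], fun N G v => ?_⟩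
  letI := G.structure
  rw [FirstOrder.Language.BoundedFormula.realize_rel₂]
  rfl

lemma Dfn.eq {d n : ℕ} (i l : Fin n) : Dfn d n (fun _ _ v => v i = v l) := by
  refine ⟨FirstOrder.Language.Term.bdEqual
    (FirstOrder.Language.Term.var (Sum.inr i)) (FirstOrder.Language.Term.var (Sum.inr l)),
    by simp [FirstOrder.Language.Term.bdEqual, qDepth], fun N G v => ?_⟩
  letI := G.structure
  rw [FirstOrder.Language.BoundedFormula.realize_bdEqual]
  rfl

lemma Dfn.all {d n : ℕ} {P : ∀ N : ℕ, SimpleGraph (Fin N) → (Fin (n + 1) → Fin N) → Prop}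
    (h : Dfn d (n + 1) P) : Dfn (d + 1) n (fun N G v => ∀ x, P N G (Fin.snoc v x)) := by
  obtain ⟨φ, h1, h2⟩ := h
  refine ⟨φ.all, by simp [qDepth, h1], fun N G v => ?_⟩
  exact forall_congr' fun x => h2 N G _

lemma Dfn.ex {d n : ℕ} {P : ∀ N : ℕ, SimpleGraph (Fin N) → (Fin (n + 1) → Fin N) → Prop}
    (h : Dfn d (n + 1) P) : Dfn (d + 1) n (fun N G v => ∃ x, P N G (Fin.snoc v x)) :=
  (h.not.all.not).congr fun N G v => by simp

lemma Dfn.exs {d n : ℕ} (t : ℕ) {P : ∀ N : ℕ, SimpleGraph (Fin N) → (Fin (n + t) → Fin N) → Prop}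
    (h : Dfn d (n + t) P) :
    Dfn (d + t) n (fun N G v => ∃ y : Fin t → Fin N, P N G (Fin.append v y)) := by
  induction t generalizing d with
  | zero =>
    refine h.congr fun N G v => ?_
    constructor
    · intro hv
      refine ⟨Fin.elim0, ?_⟩
      convert hv using 1
      simp
    · rintro ⟨y, hy⟩
      convert hy using 1
      rw [Subsingleton.elim y Fin.elim0]
      simp
  | succ t ih =>
    have h2 := ih (h.ex)
    rw [show d + (t + 1) = d + 1 + t by omega]
    refine h2.congr fun N G v => ?_
    constructor
    · rintro ⟨y, x, hyx⟩
      refine ⟨Fin.snoc y x, ?_⟩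
      rwa [Fin.append_snoc]
    · rintro ⟨y, hy⟩
      refine ⟨Fin.init y, y (Fin.last _), ?_⟩
      rw [← Fin.append_snoc, Fin.snoc_init_self]
      exact hy

/-- The clique condition: `a` together with some `y`'s forms a clique. -/
def QProp {V : Type*} {j : ℕ} (G : SimpleGraph V) (a : Fin j → V) : Prop :=
  ∃ y : Fin j → V, (∀ i l, i ≠ l → G.Adj (a i) (a l)) ∧ (∀ i l, G.Adj (a i) (y l)) ∧
    (∀ i l, i ≠ l → G.Adj (y i) (y l))

/-- The domination condition. -/
def DProp {V : Type*} {q : ℕ} (G : SimpleGraph V) (a : Fin (q + 2) → V) : Prop :=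
  ∃ c, (∀ l, c ≠ a l) ∧ ¬ G.Adj c (a 0) ∧
    (∀ i, i ≠ 0 → ∃ u, G.Adj u c ∧ (∀ l, l ≠ i → G.Adj u (a l)) ∧ ¬ G.Adj u (a i) ∧
      ∀ l, u ≠ a l) ∧
    ∀ y, (∀ i, G.Adj (a i) y) → ∃ z, G.Adj z c ∧ G.Adj z y ∧
      (∀ l, l ≠ 0 → l ≠ 1 → G.Adj z (a l)) ∧ ¬ G.Adj z (a 0) ∧ ∀ l, z ≠ a l

/-- The property with infinite spectrum. -/
def LProp {V : Type*} (q : ℕ) (G : SimpleGraph V) : Prop :=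
  ∃ a : Fin (q + 2) → V, QProp G a ∧ ¬ DProp G a

lemma dfn_Q (j : ℕ) : Dfn j j (fun _ G v => QProp G v) := by
  have h : Dfn 0 (j + j) (fun N G v =>
      (∀ i l : Fin j, i ≠ l → G.Adj (v (Fin.castAdd j i)) (v (Fin.castAdd j l))) ∧
      (∀ i l : Fin j, G.Adj (v (Fin.castAdd j i)) (v (Fin.natAdd j l))) ∧
      (∀ i l : Fin j, i ≠ l → G.Adj (v (Fin.natAdd j i)) (v (Fin.natAdd j l)))) := by
    refine Dfn.and ?_ (Dfn.and ?_ ?_)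
    · exact Dfn.forallFin fun i => Dfn.forallFin fun l => Dfn.guard _ fun _ => Dfn.adj _ _
    · exact Dfn.forallFin fun i => Dfn.forallFin fun l => Dfn.adj _ _
    · exact Dfn.forallFin fun i => Dfn.forallFin fun l => Dfn.guard _ fun _ => Dfn.adj _ _
  refine ((h.exs j).mono (by omega)).congr fun N G v => ?_
  simp only [QProp, Fin.append_left, Fin.append_right]

lemma dfn_D (q : ℕ) : Dfn 3 (q + 2) (fun _ G v => DProp G v) := by
  have hu : ∀ i : Fin (q + 2), Dfn 0 (q + 2 + 1 + 1) (fun N G v =>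
      G.Adj (v (Fin.last _)) (v (Fin.last _).castSucc) ∧
      (∀ l : Fin (q + 2), l ≠ i → G.Adj (v (Fin.last _)) (v l.castSucc.castSucc)) ∧
      ¬ G.Adj (v (Fin.last _)) (v i.castSucc.castSucc) ∧
      ∀ l : Fin (q + 2), ¬ v (Fin.last _) = v l.castSucc.castSucc) := fun i =>
    (Dfn.adj _ _).and ((Dfn.forallFin fun l => Dfn.guard _ fun _ => Dfn.adj _ _).and
      ((Dfn.adj _ _).not.and (Dfn.forallFin fun l => (Dfn.eq _ _).not)))
  have hz : Dfn 0 (q + 2 + 1 + 1 + 1) (fun N G v =>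
      G.Adj (v (Fin.last _)) (v (Fin.last _).castSucc.castSucc) ∧
      G.Adj (v (Fin.last _)) (v (Fin.last _).castSucc) ∧
      (∀ l : Fin (q + 2), l ≠ 0 → l ≠ 1 →
        G.Adj (v (Fin.last _)) (v l.castSucc.castSucc.castSucc)) ∧
      ¬ G.Adj (v (Fin.last _)) (v (0 : Fin (q + 2)).castSucc.castSucc.castSucc) ∧
      ∀ l : Fin (q + 2), ¬ v (Fin.last _) = v l.castSucc.castSucc.castSucc) :=
    (Dfn.adj _ _).and ((Dfn.adj _ _).and
      ((Dfn.forallFin fun l => Dfn.guard _ fun _ => Dfn.guard _ fun _ => Dfn.adj _ _).and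
      ((Dfn.adj _ _).not.and (Dfn.forallFin fun l => (Dfn.eq _ _).not))))
  have hy : Dfn 1 (q + 2 + 1 + 1) (fun N G v =>
      (∀ i : Fin (q + 2), G.Adj (v i.castSucc.castSucc) (v (Fin.last _)))) :=
    Dfn.forallFin fun l => Dfn.adj _ _
  have hc : Dfn 2 (q + 2 + 1) (fun N G v =>
      (∀ l : Fin (q + 2), ¬ v (Fin.last _) = v l.castSucc) ∧
      ¬ G.Adj (v (Fin.last _)) (v (0 : Fin (q + 2)).castSucc)) :=
    (Dfn.forallFin fun l => (Dfn.eq _ _).not).and (Dfn.adj _ _).not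
  have h2 := (hc.and ((Dfn.forallFin fun i => Dfn.guard (i ≠ 0) fun _ =>
    ((hu i).ex.mono (by omega : 0 + 1 ≤ 2))).and ((hy.imp hz.ex).all))).ex
  refine h2.congr fun N G v => ?_
  simp only [DProp, Fin.snoc_last, Fin.snoc_castSucc, and_assoc, ne_eq]

lemma Dfn.close (m : ℕ) : ∀ {d : ℕ}
    {P : ∀ N : ℕ, SimpleGraph (Fin N) → (Fin m → Fin N) → Prop}, Dfn d m P →
    ∃ φ : FirstOrder.Language.graph.Sentence, qDepth φ ≤ d + m ∧
      ∀ (N : ℕ) (G : SimpleGraph (Fin N)), GraphSat G φ ↔ ∃ v, P N G v := by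
  induction m with
  | zero =>
    rintro d P ⟨φ, h1, h2⟩
    refine ⟨φ, h1, fun N G => ?_⟩
    refine (h2 N G default).trans ⟨fun h => ⟨_, h⟩, ?_⟩
    rintro ⟨v, hv⟩
    rwa [Subsingleton.elim default v]
  | succ m ih =>
    intro d P h
    obtain ⟨φ, h1, h2⟩ := ih h.ex
    refine ⟨φ, by omega, fun N G => (h2 N G).trans ⟨?_, ?_⟩⟩
    · rintro ⟨v, x, h⟩
      exact ⟨_, h⟩
    · rintro ⟨v, h⟩
      exact ⟨Fin.init v, v (Fin.last _), by rwa [Fin.snoc_init_self]⟩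

lemma exists_sentence (q : ℕ) : ∃ φ : FirstOrder.Language.graph.Sentence,
    qDepth φ ≤ q + 2 + max (q + 2) 3 ∧
    ∀ (N : ℕ) (G : SimpleGraph (Fin N)), GraphSat G φ ↔ LProp q G := by
  obtain ⟨φ, h1, h2⟩ := (((dfn_Q (q + 2)).mono (le_max_left _ 3)).and
      ((dfn_D q).mono (le_max_right (q + 2) 3)).not).close
  exact ⟨φ, by omega, h2⟩

end RandomGraphSpectra

namespace RandomGraphSpectra

/-! ### Part 2: finite product probability -/

section Prob

variable {E : Type*} [Fintype E] [DecidableEq E]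

/-- weight of one bit -/
noncomputable def bw (p : ℝ) (b : Bool) : ℝ := if b then p else 1 - p

/-- weight of a configuration -/
noncomputable def Wt (p : ℝ) (ω : E → Bool) : ℝ := ∏ e, bw p (ω e)

/-- expectation -/
noncomputable def Ex (p : ℝ) (f : (E → Bool) → ℝ) : ℝ := ∑ ω, Wt p ω * f ω

open Classical in
/-- indicator -/
noncomputable def ind (A : Prop) : ℝ := if A then 1 else 0

/-- probability -/
noncomputable def Pr (p : ℝ) (A : (E → Bool) → Prop) : ℝ := Ex p (fun ω => ind (A ω))

lemma ind_nonneg (A : Prop) : 0 ≤ ind A := by unfold ind; split_ifs <;> norm_num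
lemma ind_le_one (A : Prop) : ind A ≤ 1 := by unfold ind; split_ifs <;> norm_num
lemma ind_true {A : Prop} (h : A) : ind A = 1 := by simp [ind, h]
lemma ind_false {A : Prop} (h : ¬ A) : ind A = 0 := by simp [ind, h]
lemma ind_mono {A B : Prop} (h : A → B) : ind A ≤ ind B := by
  by_cases hA : A
  · rw [ind_true hA, ind_true (h hA)]
  · rw [ind_false hA]; exact ind_nonneg B
lemma ind_and (A B : Prop) : ind (A ∧ B) = ind A * ind B := by
  by_cases hA : A <;> by_cases hB : B <;> simp [ind, hA, hB]
lemma ind_not (A : Prop) : ind (¬ A) = 1 - ind A := by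
  by_cases hA : A <;> simp [ind, hA]
lemma ind_congr {A B : Prop} (h : A ↔ B) : ind A = ind B := by rw [propext h]
lemma ind_or_le (A B : Prop) : ind (A ∨ B) ≤ ind A + ind B := by
  by_cases hA : A <;> by_cases hB : B <;> simp [ind, hA, hB]
lemma ind_forall {ι : Type*} (s : Finset ι) (A : ι → Prop) :
    ind (∀ i ∈ s, A i) = ∏ i ∈ s, ind (A i) := by
  classical
  by_cases h : ∀ i ∈ s, A i
  · rw [ind_true h, Finset.prod_eq_one fun i hi => ind_true (h i hi)]
  · rw [ind_false h]
    push Not at h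
    obtain ⟨i, hi, hA⟩ := h
    exact (Finset.prod_eq_zero hi (ind_false hA)).symm
lemma ind_exists_le {ι : Type*} (s : Finset ι) (A : ι → Prop) :
    ind (∃ i ∈ s, A i) ≤ ∑ i ∈ s, ind (A i) := by
  classical
  by_cases h : ∃ i ∈ s, A i
  · rw [ind_true h]
    obtain ⟨i, hi, hA⟩ := h
    rw [← ind_true hA]
    exact Finset.single_le_sum (f := fun i => ind (A i)) (fun i _ => ind_nonneg _) hi
  · rw [ind_false h]
    exact Finset.sum_nonneg fun i _ => ind_nonneg _

lemma bw_nonneg {p : ℝ} (h0 : 0 ≤ p) (h1 : p ≤ 1) (b : Bool) : 0 ≤ bw p b := by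
  unfold bw; split_ifs <;> linarith

lemma Wt_nonneg {p : ℝ} (h0 : 0 ≤ p) (h1 : p ≤ 1) (ω : E → Bool) : 0 ≤ Wt p ω :=
  Finset.prod_nonneg fun _ _ => bw_nonneg h0 h1 _

lemma Ex_prod (p : ℝ) (h : E → Bool → ℝ) :
    Ex p (fun ω : E → Bool => ∏ e, h e (ω e)) = ∏ e, (p * h e true + (1 - p) * h e false) := by
  have : ∀ e, (p * h e true + (1 - p) * h e false) = ∑ b : Bool, bw p b * h e b := by
    intro e; simp [bw]
  simp_rw [this]
  rw [Finset.prod_univ_sum, Fintype.piFinset_univ]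
  simp only [Ex, Wt, Finset.prod_mul_distrib]

lemma Ex_one (p : ℝ) : Ex p (fun _ : E → Bool => (1 : ℝ)) = 1 := by
  have := Ex_prod (E := E) p (fun _ _ => 1)
  simpa using this

lemma sum_Wt (p : ℝ) : ∑ ω : E → Bool, Wt p ω = 1 := by
  simpa [Ex] using Ex_one (E := E) p

lemma Ex_mono {p : ℝ} (h0 : 0 ≤ p) (h1 : p ≤ 1) {f g : (E → Bool) → ℝ} (h : ∀ ω, f ω ≤ g ω) :
    Ex p f ≤ Ex p g :=
  Finset.sum_le_sum fun ω _ => mul_le_mul_of_nonneg_left (h ω) (Wt_nonneg h0 h1 ω)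

lemma Ex_nonneg {p : ℝ} (h0 : 0 ≤ p) (h1 : p ≤ 1) {f : (E → Bool) → ℝ} (h : ∀ ω, 0 ≤ f ω) :
    0 ≤ Ex p f :=
  Finset.sum_nonneg fun ω _ => mul_nonneg (Wt_nonneg h0 h1 ω) (h ω)

lemma Ex_add (p : ℝ) (f g : (E → Bool) → ℝ) :
    Ex p (fun ω => f ω + g ω) = Ex p f + Ex p g := by
  simp [Ex, mul_add, Finset.sum_add_distrib]

lemma Ex_sub (p : ℝ) (f g : (E → Bool) → ℝ) :
    Ex p (fun ω => f ω - g ω) = Ex p f - Ex p g := by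
  simp [Ex, mul_sub, Finset.sum_sub_distrib]

lemma Ex_sum {ι : Type*} (p : ℝ) (s : Finset ι) (f : ι → (E → Bool) → ℝ) :
    Ex p (fun ω => ∑ i ∈ s, f i ω) = ∑ i ∈ s, Ex p (f i) := by
  simp only [Ex, Finset.mul_sum]
  exact Finset.sum_comm

lemma Ex_const_mul (p c : ℝ) (f : (E → Bool) → ℝ) : Ex p (fun ω => c * f ω) = c * Ex p f := by
  simp only [Ex, Finset.mul_sum]
  exact Finset.sum_congr rfl fun ω _ => by ring

lemma Ex_const (p c : ℝ) : Ex p (fun _ : E → Bool => c) = c := by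
  have := Ex_const_mul (E := E) p c (fun _ => 1)
  simpa [Ex_one] using this

lemma Pr_nonneg {p : ℝ} (h0 : 0 ≤ p) (h1 : p ≤ 1) (A : (E → Bool) → Prop) : 0 ≤ Pr p A :=
  Ex_nonneg h0 h1 fun _ => ind_nonneg _

lemma Pr_mono {p : ℝ} (h0 : 0 ≤ p) (h1 : p ≤ 1) {A B : (E → Bool) → Prop}
    (h : ∀ ω, A ω → B ω) : Pr p A ≤ Pr p B :=
  Ex_mono h0 h1 fun ω => ind_mono (h ω)

lemma Pr_congr {p : ℝ} {A B : (E → Bool) → Prop}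
    (h : ∀ ω, A ω ↔ B ω) : Pr p A = Pr p B := by
  have : A = B := funext fun ω => propext (h ω)
  rw [this]

lemma Pr_le_one {p : ℝ} (h0 : 0 ≤ p) (h1 : p ≤ 1) (A : (E → Bool) → Prop) : Pr p A ≤ 1 := by
  rw [← Ex_one (E := E) p]
  exact Ex_mono h0 h1 fun _ => ind_le_one _

lemma Pr_not (p : ℝ) (A : (E → Bool) → Prop) : Pr p (fun ω => ¬ A ω) = 1 - Pr p A := by
  simp only [Pr, ind_not]
  rw [Ex_sub, Ex_one]

lemma Pr_or_le {p : ℝ} (h0 : 0 ≤ p) (h1 : p ≤ 1) (A B : (E → Bool) → Prop) :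
    Pr p (fun ω => A ω ∨ B ω) ≤ Pr p A + Pr p B := by
  unfold Pr
  rw [← Ex_add]
  exact Ex_mono h0 h1 fun _ => ind_or_le _ _

lemma Pr_exists_le {ι : Type*} {p : ℝ} (h0 : 0 ≤ p) (h1 : p ≤ 1) (s : Finset ι)
    (A : ι → (E → Bool) → Prop) :
    Pr p (fun ω => ∃ i ∈ s, A i ω) ≤ ∑ i ∈ s, Pr p (A i) := by
  unfold Pr
  rw [← Ex_sum]
  exact Ex_mono h0 h1 fun _ => ind_exists_le _ _

lemma Pr_all_true (p : ℝ) (T : Finset E) :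
    Pr p (fun ω : E → Bool => ∀ e ∈ T, ω e = true) = p ^ T.card := by
  have h1 : ∀ ω : E → Bool, ind (∀ e ∈ T, ω e = true)
      = ∏ e, (fun e b => if e ∈ T then ind (b = true) else 1) e (ω e) := by
    intro ω
    rw [ind_forall]
    simp only
    rw [Finset.prod_ite_mem, Finset.univ_inter]
  simp only [Pr, h1]
  refine (Ex_prod p (fun (e : E) (b : Bool) => if e ∈ T then ind (b = true) else 1)).trans ?_
  have : ∀ e, (p * (if e ∈ T then ind (true = true) else 1)
      + (1 - p) * (if e ∈ T then ind (false = true) else 1)) = if e ∈ T then p else 1 := by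
    intro e
    split_ifs <;> simp [ind]
  refine (Finset.prod_congr rfl fun e _ => this e).trans ?_
  rw [Finset.prod_ite_mem, Finset.univ_inter, Finset.prod_const]

open Classical in
/-- mix two configurations -/
noncomputable def mix (S : Set E) (ω ω' : E → Bool) : E → Bool := fun e => if e ∈ S then ω e else ω' e

lemma mix_mix (S : Set E) (ω ω' : E → Bool) : mix S (mix S ω ω') (mix S ω' ω) = ω := by
  funext e; unfold mix; split_ifs <;> rfl

lemma Wt_mix (p : ℝ) (S : Set E) (ω ω' : E → Bool) :
    Wt p (mix S ω ω') * Wt p (mix S ω' ω) = Wt p ω * Wt p ω' := by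
  unfold Wt
  rw [← Finset.prod_mul_distrib, ← Finset.prod_mul_distrib]
  refine Finset.prod_congr rfl fun e _ => ?_
  unfold mix
  split_ifs
  · rfl
  · ring

lemma Ex_indep (p : ℝ) (S : Set E) {f g : (E → Bool) → ℝ} (hf : DependsOn f S)
    (hg : DependsOn g Sᶜ) : Ex p (fun ω => f ω * g ω) = Ex p f * Ex p g := by
  have e1 : Ex p f * Ex p g = ∑ x : (E → Bool) × (E → Bool),
      Wt p x.1 * Wt p x.2 * (f x.1 * g x.2) := by
    rw [Fintype.sum_prod_type]
    simp only [Ex, Finset.sum_mul, Finset.mul_sum]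
    rw [Finset.sum_comm]
    exact Finset.sum_congr rfl fun ω _ => Finset.sum_congr rfl fun ω' _ => by ring
  have e2 : Ex p (fun ω => f ω * g ω) = ∑ x : (E → Bool) × (E → Bool),
      Wt p x.1 * Wt p x.2 * (f x.1 * g x.1) := by
    rw [Fintype.sum_prod_type]
    have : ∀ ω : E → Bool, ∑ ω' : E → Bool, Wt p ω * Wt p ω' * (f ω * g ω)
        = Wt p ω * (f ω * g ω) := by
      intro ω
      rw [← Finset.sum_mul, ← Finset.mul_sum, sum_Wt, mul_one]
    simp only [this, Ex]
  rw [e1, e2]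
  let σ : (E → Bool) × (E → Bool) ≃ (E → Bool) × (E → Bool) :=
    { toFun := fun x => (mix S x.1 x.2, mix S x.2 x.1)
      invFun := fun x => (mix S x.1 x.2, mix S x.2 x.1)
      left_inv := fun x => by simp [mix_mix]
      right_inv := fun x => by simp [mix_mix] }
  rw [← Equiv.sum_comp σ]
  refine Finset.sum_congr rfl fun x _ => ?_
  change Wt p (mix S x.1 x.2) * Wt p (mix S x.2 x.1) * (f (mix S x.1 x.2) * g (mix S x.1 x.2)) = _
  rw [Wt_mix]
  have h1 : f (mix S x.1 x.2) = f x.1 := hf fun e he => by simp [mix, he]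
  have h2 : g (mix S x.1 x.2) = g x.2 := hg fun e he => by
    have : e ∉ S := he
    simp [mix, this]
  rw [h1, h2]

lemma dependsOn_prod {ι : Type*} (s : Finset ι) (f : ι → (E → Bool) → ℝ) (S : ι → Set E)
    (h : ∀ i ∈ s, DependsOn (f i) (S i)) :
    DependsOn (fun ω => ∏ i ∈ s, f i ω) (⋃ i ∈ s, S i) := by
  intro x y hxy
  refine Finset.prod_congr rfl fun i hi => h i hi fun e he => hxy e ?_
  simp only [Set.mem_iUnion]
  exact ⟨i, hi, he⟩

lemma Ex_prod_indep {ι : Type*} [DecidableEq ι] (p : ℝ) (s : Finset ι)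
    (f : ι → (E → Bool) → ℝ) (S : ι → Set E)
    (h : ∀ i ∈ s, DependsOn (f i) (S i))
    (hd : ∀ i ∈ s, ∀ i' ∈ s, i ≠ i' → Disjoint (S i) (S i')) :
    Ex p (fun ω => ∏ i ∈ s, f i ω) = ∏ i ∈ s, Ex p (f i) := by
  induction s using Finset.induction_on with
  | empty => simp [Ex_one]
  | insert a s ha ih =>
    simp only [Finset.prod_insert ha]
    rw [Ex_indep p (S a) (h a (Finset.mem_insert_self a s)), ih]
    · exact fun i hi => h i (Finset.mem_insert_of_mem hi)
    · exact fun i hi i' hi' => hd i (Finset.mem_insert_of_mem hi) i' (Finset.mem_insert_of_mem hi')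
    · refine DependsOn.mono ?_ (dependsOn_prod s f S fun i hi => h i (Finset.mem_insert_of_mem hi))
      intro e he
      simp only [Set.mem_iUnion] at he
      obtain ⟨i, hi, he⟩ := he
      have := hd a (Finset.mem_insert_self a s) i (Finset.mem_insert_of_mem hi)
        (by rintro rfl; exact ha hi)
      exact fun hea => Set.disjoint_left.mp this hea he

lemma dependsOn_ind {A : (E → Bool) → Prop} {S : Set E} (h : DependsOn A S) :
    DependsOn (fun ω => ind (A ω)) S := fun x y hxy => by
  simp only [h hxy]

lemma Pr_indep (p : ℝ) (S : Set E) {A B : (E → Bool) → Prop} (hA : DependsOn A S)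
    (hB : DependsOn B Sᶜ) : Pr p (fun ω => A ω ∧ B ω) = Pr p A * Pr p B := by
  simp only [Pr, ind_and]
  exact Ex_indep p S (dependsOn_ind hA) (dependsOn_ind hB)

lemma Pr_forall_indep {ι : Type*} [DecidableEq ι] (p : ℝ) (s : Finset ι)
    (A : ι → (E → Bool) → Prop) (S : ι → Set E)
    (h : ∀ i ∈ s, DependsOn (A i) (S i))
    (hd : ∀ i ∈ s, ∀ i' ∈ s, i ≠ i' → Disjoint (S i) (S i')) :
    Pr p (fun ω => ∀ i ∈ s, A i ω) = ∏ i ∈ s, Pr p (A i) := by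
  simp only [Pr, ind_forall]
  exact Ex_prod_indep p s _ S (fun i hi => dependsOn_ind (h i hi)) hd

lemma bw_fkg (p : ℝ) (a b : Bool) : bw p a * bw p b = bw p (a ⊓ b) * bw p (a ⊔ b) := by
  cases a <;> cases b <;> simp [bw, mul_comm]

lemma harris {p : ℝ} (h0 : 0 ≤ p) (h1 : p ≤ 1) {f g : (E → Bool) → ℝ}
    (hf0 : 0 ≤ f) (hg0 : 0 ≤ g) (hf : Monotone f) (hg : Monotone g) :
    Ex p f * Ex p g ≤ Ex p (fun ω => f ω * g ω) := by
  have := fkg (μ := (Wt p : (E → Bool) → ℝ)) (f := f) (g := g)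
    (fun ω => Wt_nonneg h0 h1 ω) hf0 hg0 hf hg (fun a b => by
      unfold Wt
      rw [← Finset.prod_mul_distrib, ← Finset.prod_mul_distrib]
      exact (Finset.prod_congr rfl fun e _ => bw_fkg p _ _).le)
  rwa [sum_Wt, one_mul] at this

/-- Harris inequality for complements of increasing events. -/
lemma harris_not {p : ℝ} (h0 : 0 ≤ p) (h1 : p ≤ 1) {A B : (E → Bool) → Prop}
    (hA : Monotone A) (hB : Monotone B) :
    Pr p (fun ω => ¬ A ω) * Pr p (fun ω => ¬ B ω) ≤ Pr p (fun ω => ¬ A ω ∧ ¬ B ω) := by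
  have := harris h0 h1 (f := fun ω => ind (A ω)) (g := fun ω => ind (B ω))
    (fun _ => ind_nonneg _) (fun _ => ind_nonneg _) (fun x y h => ind_mono (hA h))
    (fun x y h => ind_mono (hB h))
  rw [Pr_not, Pr_not]
  have e : Pr p (fun ω => ¬ A ω ∧ ¬ B ω) = 1 - Pr p A - Pr p B +
      Ex p (fun ω => ind (A ω) * ind (B ω)) := by
    rw [← Ex_one (E := E) p]
    unfold Pr
    rw [← Ex_sub, ← Ex_sub, ← Ex_add]
    congr 1
    funext ω
    rw [ind_and, ind_not, ind_not]
    ring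
  rw [e]
  unfold Pr at *
  linarith

lemma harris_forall {ι : Type*} {p : ℝ} (h0 : 0 ≤ p) (h1 : p ≤ 1) (s : Finset ι)
    {A : ι → (E → Bool) → Prop} (hA : ∀ i, Monotone (A i)) :
    ∏ i ∈ s, Pr p (fun ω => ¬ A i ω) ≤ Pr p (fun ω => ∀ i ∈ s, ¬ A i ω) := by
  classical
  induction s using Finset.induction_on with
  | empty => simp [Pr, ind, Ex_one]
  | insert a s ha ih =>
    rw [Finset.prod_insert ha]
    calc _ ≤ Pr p (fun ω => ¬ A a ω) * Pr p (fun ω => ¬ ∃ i ∈ s, A i ω) := by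
          refine mul_le_mul_of_nonneg_left ?_ (Pr_nonneg h0 h1 _)
          simpa using ih
      _ ≤ _ := harris_not h0 h1 (hA a) (fun x y h => by
          rintro ⟨i, hi, h'⟩
          exact ⟨i, hi, hA i h h'⟩)
      _ = _ := Pr_congr fun ω => by simp

lemma second_moment {p : ℝ} (h0 : 0 ≤ p) (h1 : p ≤ 1) (X : (E → Bool) → ℝ) :
    (Ex p X) ^ 2 ≤ Pr p (fun ω => X ω ≠ 0) * Ex p (fun ω => X ω ^ 2) := by
  refine Finset.sum_sq_le_sum_mul_sum_of_sq_eq_mul _ (fun ω _ => ?_) (fun ω _ => ?_)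
    (fun ω _ => ?_)
  · exact mul_nonneg (Wt_nonneg h0 h1 ω) (ind_nonneg _)
  · exact mul_nonneg (Wt_nonneg h0 h1 ω) (sq_nonneg _)
  · by_cases h : X ω = 0
    · simp [h]
    · simp only
      rw [ind_true (A := X ω ≠ 0) h]; ring

end Prob

/-- the graph of a configuration -/
def gr {n : ℕ} (ω : Sym2 (Fin n) → Bool) : SimpleGraph (Fin n) :=
  SimpleGraph.fromEdgeSet {e | ω e = true}

lemma gr_adj {n : ℕ} (ω : Sym2 (Fin n) → Bool) (x y : Fin n) :
    (gr ω).Adj x y ↔ ω s(x, y) = true ∧ x ≠ y := by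
  simp [gr]

lemma gr_eq_iff {n : ℕ} (ω : Sym2 (Fin n) → Bool) (G : SimpleGraph (Fin n)) :
    gr ω = G ↔ ∀ e, ¬ e.IsDiag → (ω e = true ↔ e ∈ G.edgeSet) := by
  constructor
  · rintro rfl e he
    simp [gr, SimpleGraph.edgeSet_fromEdgeSet, he]
  · intro h
    ext x y
    rw [gr_adj]
    by_cases hxy : x = y
    · subst hxy; simp
    · rw [h s(x, y) (by simpa using hxy)]; simp [hxy]

open Classical in
lemma sum_fiber (n : ℕ) (p : ℝ) (G : SimpleGraph (Fin n)) :
    Pr p (fun ω => gr ω = G) = weight n p G := by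
  have h1 : ∀ ω : Sym2 (Fin n) → Bool, ind (gr ω = G) = ∏ e, (fun (e : Sym2 (Fin n)) (b : Bool) =>
      if e.IsDiag then 1 else ind (b = true ↔ e ∈ G.edgeSet)) e (ω e) := by
    intro ω
    rw [ind_congr (gr_eq_iff ω G)]
    have : (∀ e, ¬ e.IsDiag → (ω e = true ↔ e ∈ G.edgeSet)) ↔
        ∀ e ∈ Finset.univ.filter (fun e : Sym2 (Fin n) => ¬ e.IsDiag),
          (ω e = true ↔ e ∈ G.edgeSet) := by simp
    rw [ind_congr this, ind_forall, Finset.prod_filter]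
    exact Finset.prod_congr rfl fun e _ => by simp only [ite_not]
  simp only [Pr, h1]
  refine (Ex_prod p (fun (e : Sym2 (Fin n)) (b : Bool) =>
      if e.IsDiag then 1 else ind (b = true ↔ e ∈ G.edgeSet))).trans ?_
  have h2 : ∀ e : Sym2 (Fin n), (p * (if e.IsDiag then 1 else ind (true = true ↔ e ∈ G.edgeSet))
      + (1 - p) * (if e.IsDiag then 1 else ind (false = true ↔ e ∈ G.edgeSet)))
      = (if e ∈ G.edgeSet then p else 1) * (if ¬ e.IsDiag ∧ e ∉ G.edgeSet then 1 - p else 1) := by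
    intro e
    by_cases hd : e.IsDiag
    · have : e ∉ G.edgeSet := fun h => G.not_isDiag_of_mem_edgeSet h hd
      simp [hd, this]
    · by_cases he : e ∈ G.edgeSet <;> simp [hd, he, ind]
  refine (Finset.prod_congr rfl fun e _ => h2 e).trans ?_
  rw [Finset.prod_mul_distrib, ← Finset.prod_filter, ← Finset.prod_filter, Finset.prod_const,
    Finset.prod_const, weight]
  have h3 : (Finset.univ.filter (fun e : Sym2 (Fin n) => e ∈ G.edgeSet)).card = edgeCount G := by
    rw [edgeCount, Nat.card_eq_fintype_card, Fintype.card_subtype]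
  have h4 : (Finset.univ.filter (fun e : Sym2 (Fin n) => ¬ e.IsDiag ∧ e ∉ G.edgeSet)).card
      = n.choose 2 - edgeCount G := by
    have h5 := Sym2.card_subtype_not_diag (α := Fin n)
    rw [Fintype.card_subtype, Fintype.card_fin] at h5
    rw [← h5, ← h3, ← Finset.card_sdiff_of_subset]
    · congr 1
      ext e
      simp
    · intro e he
      simp only [Finset.mem_filter, Finset.mem_univ, true_and] at he ⊢
      exact G.not_isDiag_of_mem_edgeSet he
  rw [h3, h4]

lemma probPred_eq (n : ℕ) (p : ℝ) (P : SimpleGraph (Fin n) → Prop) :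
    probPred n p P = Pr p (fun ω => P (gr ω)) := by
  classical
  rw [probPred, finsum_eq_sum_of_fintype]
  have h : ∀ ω : Sym2 (Fin n) → Bool, ind (P (gr ω)) = ∑ G, ind (P G) * ind (gr ω = G) := by
    intro ω
    rw [Finset.sum_eq_single (gr ω)]
    · rw [ind_true (A := gr ω = gr ω) rfl, mul_one]
    · intro G _ hG
      rw [ind_false (A := gr ω = G) (Ne.symm hG), mul_zero]
    · simp
  simp only [Pr, h]
  rw [Ex_sum]
  refine Finset.sum_congr rfl fun G _ => ?_
  rw [Ex_const_mul]
  have := sum_fiber n p G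
  unfold Pr at this
  rw [this]
  unfold ind
  split_ifs <;> simp

end RandomGraphSpectra

namespace RandomGraphSpectra

/-! ### Part 3: combinatorics of the pattern graph -/

/-- edge relation of the pattern graph -/
def HE (j x y : ℕ) : Prop := x < y ∧ (x < j ∨ y < 2 * j)

instance (j x y : ℕ) : Decidable (HE j x y) := by unfold HE; infer_instance

/-- edges of the pattern graph on `v` vertices -/
def EH (j v : ℕ) : Finset (Fin v × Fin v) := Finset.univ.filter fun xy => HE j xy.1 xy.2

/-- edges of the pattern graph inside a set -/
def EHin (j v : ℕ) (S : Finset (Fin v)) : Finset (Fin v × Fin v) :=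
  (EH j v).filter fun xy => xy.1 ∈ S ∧ xy.2 ∈ S

lemma EHin_card_aux (j v : ℕ) (S : Finset (Fin v)) :
    2 * (EHin j v S).card + (S.filter fun x => x.val < 2 * j).card ≤
      (S.filter fun x => x.val < 2 * j).card * (S.filter fun x => x.val < 2 * j).card +
      2 * j * (S.filter fun x => 2 * j ≤ x.val).card := by
  induction S using Finset.induction_on_max with
  | empty => simp [EHin]
  | insert a S hS ih =>
    have ha : a ∉ S := fun h => lt_irrefl _ (hS a h)
    have h1 : EHin j v (insert a S) ⊆ EHin j v S ∪
        ((S.filter fun x => x.val < j ∨ a.val < 2 * j).image fun x => (x, a)) := by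
      intro ⟨x, y⟩ hxy
      simp only [EHin, EH, Finset.mem_filter, Finset.mem_univ, true_and, Finset.mem_insert,
        Finset.mem_union, Finset.mem_image, Prod.mk.injEq] at hxy ⊢
      simp only [HE] at hxy ⊢
      obtain ⟨⟨h1, h2⟩, h3, h4⟩ := hxy
      have hlt : x < y := h1
      rcases h4 with rfl | h4
      · right
        rcases h3 with rfl | h3
        · exact absurd hlt (lt_irrefl _)
        · exact ⟨x, ⟨h3, h2⟩, rfl, rfl⟩
      · rcases h3 with rfl | h3
        · exact absurd (hS y h4) (not_lt.mpr hlt.le)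
        · exact Or.inl ⟨⟨h1, h2⟩, h3, h4⟩
    have h2 := (Finset.card_le_card h1).trans (Finset.card_union_le _ _)
    have h3 := Finset.card_image_le (s := S.filter fun x => x.val < j ∨ a.val < 2 * j)
      (f := fun x => (x, a))
    by_cases h : a.val < 2 * j
    · have e1 : (insert a S).filter (fun x => x.val < 2 * j) =
          insert a (S.filter fun x => x.val < 2 * j) := by
        rw [Finset.filter_insert, if_pos h]
      have e2 : (insert a S).filter (fun x => 2 * j ≤ x.val) =
          (S.filter fun x => 2 * j ≤ x.val) := by
        rw [Finset.filter_insert, if_neg (by omega)]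
      have e3 : (S.filter fun x => x.val < j ∨ a.val < 2 * j) =
          S.filter (fun x => x.val < 2 * j) := by
        refine Finset.filter_congr fun x hx => ?_
        have : x.val < a.val := hS x hx
        simp only [h, or_true, true_iff]
        omega
      rw [e1, e2, Finset.card_insert_of_notMem (by simp [ha])]
      rw [e3] at h2 h3
      generalize (S.filter fun x => x.val < 2 * j).card = s at *
      nlinarith
    · have e1 : (insert a S).filter (fun x => x.val < 2 * j) =
          (S.filter fun x => x.val < 2 * j) := by
        rw [Finset.filter_insert, if_neg h]
      have e2 : (insert a S).filter (fun x => 2 * j ≤ x.val) =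
          insert a (S.filter fun x => 2 * j ≤ x.val) := by
        rw [Finset.filter_insert, if_pos (by omega)]
      have e3 : (S.filter fun x => x.val < j ∨ a.val < 2 * j).card ≤ j := by
        calc _ ≤ (Finset.range j).card := by
              refine Finset.card_le_card_of_injOn Fin.val ?_ Fin.val_injective.injOn
              intro x hx
              simp only [Finset.coe_filter, Set.mem_setOf_eq, Finset.coe_range, Set.mem_Iio] at *
              omega
          _ = j := by simp
      rw [e1, e2, Finset.card_insert_of_notMem (by simp [ha])]
      nlinarith

lemma card_lt_le {v : ℕ} (S : Finset (Fin v)) (m : ℕ) :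
    (S.filter fun x => x.val < m).card ≤ m := by
  calc _ ≤ (Finset.range m).card := by
        refine Finset.card_le_card_of_injOn Fin.val ?_ Fin.val_injective.injOn
        intro x hx
        simp only [Finset.coe_filter, Set.mem_setOf_eq, Finset.coe_range, Set.mem_Iio] at *
        omega
    _ = m := by simp

lemma EHin_card (j v : ℕ) (S : Finset (Fin v)) (hS : S.Nonempty) :
    (EHin j v S).card + j ≤ j * S.card := by
  have h := EHin_card_aux j v S
  have h1 := card_lt_le S (2 * j)
  have h2 := Finset.card_filter_add_card_filter_not (s := S) (fun x => x.val < 2 * j)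
  simp only [not_lt] at h2
  rw [← h2]
  rcases Nat.eq_zero_or_pos (S.filter fun x => x.val < 2 * j).card with h0 | h0
  · have : EHin j v S = ∅ := by
      rw [Finset.card_eq_zero, Finset.filter_eq_empty_iff] at h0
      rw [EHin, Finset.filter_eq_empty_iff]
      intro ⟨x, y⟩ hxy ⟨hx, hy⟩
      simp only [EH, Finset.mem_filter, Finset.mem_univ, true_and] at hxy
      simp only [HE] at hxy
      have hx2 : ¬ x.val < 2 * j := h0 hx
      have hy2 : ¬ y.val < 2 * j := h0 hy
      omega
    rw [this, h0]
    have : 0 < S.card := hS.card_pos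
    have : 1 ≤ (S.filter fun x => 2 * j ≤ x.val).card := by omega
    simp only [Finset.card_empty, zero_add]
    nlinarith
  · generalize (S.filter fun x => x.val < 2 * j).card = s at *
    generalize (S.filter fun x => 2 * j ≤ x.val).card = t at *
    obtain ⟨r, rfl⟩ : ∃ r, s = r + 1 := ⟨s - 1, by omega⟩
    obtain ⟨u, hu⟩ : ∃ u, 2 * j = r + 1 + u := ⟨2 * j - (r + 1), by omega⟩
    nlinarith [Nat.zero_le (r * u)]

lemma EH_card (j v : ℕ) (hv : 2 * j ≤ v) (hj : 1 ≤ j) : (EH j v).card + j = j * v := by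
  have h : (EH j v).card = ∑ y : Fin v, (if y.val < 2 * j then y.val else j) := by
    rw [EH, Finset.card_filter, Fintype.sum_prod_type_right]
    refine Finset.sum_congr rfl fun y _ => ?_
    rw [← Finset.card_filter]
    have : (Finset.univ.filter fun x : Fin v => HE j x y).card =
        (Finset.range (if y.val < 2 * j then y.val else j)).card := by
      refine Finset.card_bij (fun x _ => x.val) ?_ ?_ ?_
      · intro x hx
        simp only [Finset.mem_filter, Finset.mem_univ, true_and, Finset.mem_range] at hx ⊢
        simp only [HE] at hx
        split_ifs <;> omega
      · intro x _ x' _ h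
        exact Fin.ext h
      · intro b hb
        have hy := y.isLt
        simp only [Finset.mem_range] at hb
        refine ⟨⟨b, by split_ifs at hb <;> omega⟩, ?_, rfl⟩
        simp only [Finset.mem_filter, Finset.mem_univ, true_and]
        simp only [HE]
        split_ifs at hb <;> omega
    rw [this, Finset.card_range]
  rw [h, Fin.sum_univ_eq_sum_range (fun y => if y < 2 * j then y else j) v]
  obtain ⟨w, rfl⟩ := Nat.exists_eq_add_of_le hv
  rw [Finset.sum_range_add]
  have h1 : ∑ y ∈ Finset.range (2 * j), (if y < 2 * j then y else j) + j = j * (2 * j) := by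
    rw [Finset.sum_congr rfl (g := fun y => y) fun y hy => if_pos (Finset.mem_range.mp hy)]
    have := Finset.sum_range_id_mul_two (2 * j)
    obtain ⟨i, rfl⟩ : ∃ i, j = i + 1 := ⟨j - 1, by omega⟩
    have e : 2 * (i + 1) - 1 = 2 * i + 1 := by omega
    rw [e] at this
    nlinarith
  have h2 : ∑ y ∈ Finset.range w, (if 2 * j + y < 2 * j then 2 * j + y else j) = w * j := by
    rw [Finset.sum_congr rfl (g := fun _ => j) fun y hy => if_neg (by omega)]
    simp
  rw [h2]
  nlinarith

/-- The sets of required neighbours. -/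
def Fidx (j v : ℕ) (x : Fin v) : Finset (Fin v) :=
  if x.val < j then Finset.univ.filter fun l => l.val < j ∧ l ≠ x
  else Finset.univ.filter fun l => l = x ∨ (2 ≤ l.val ∧ l.val < j)

lemma card_lt_eq {v : ℕ} (m : ℕ) (hm : m ≤ v) :
    (Finset.univ.filter fun x : Fin v => x.val < m).card = m := by
  refine (Finset.card_bij (t := Finset.range m) (fun x _ => x.val) ?_ ?_ ?_).trans (by simp)
  · intro x hx; simpa using hx
  · intro x _ x' _ h; exact Fin.ext h
  · intro b hb
    simp only [Finset.mem_range] at hb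
    exact ⟨⟨b, by omega⟩, by simpa using hb, rfl⟩

lemma Fidx_ineq (j B : ℕ) (hj : 2 ≤ j) (hB : j ^ 2 ≤ B + 1) (T : Finset (Fin (B + 1)))
    (hT : T.Nonempty) (h0 : 0 ∉ T) :
    j * (B + T.card) ≤ (1 + (T.biUnion (Fidx j (B + 1))).card) * (B + 1) := by
  have hjB : j ≤ B + 1 := by nlinarith
  set U := T.biUnion (Fidx j (B + 1)) with hU
  set Ty := T.filter fun x => ¬ x.val < j with hTy
  set Ti := T.filter fun x => x.val < j with hTi
  have hcard : Ti.card + Ty.card = T.card := Finset.card_filter_add_card_filter_not _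
  have hTyU : ∀ x ∈ Ty, x ∈ U := by
    intro x hx
    rw [hTy, Finset.mem_filter] at hx
    rw [hU, Finset.mem_biUnion]
    exact ⟨x, hx.1, by simp [Fidx, hx.2]⟩
  have hTiU : ∀ i ∈ Ti, ∀ l : Fin (B + 1), l.val < j → l ≠ i → l ∈ U := by
    intro i hi l hl hli
    rw [hTi, Finset.mem_filter] at hi
    rw [hU, Finset.mem_biUnion]
    exact ⟨i, hi.1, by simp [Fidx, hi.2, hl, hli]⟩
  have hdisj : ∀ A : Finset (Fin (B + 1)), (∀ x ∈ A, x.val < j) → A ⊆ U →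
      Ty.card + A.card ≤ U.card := by
    intro A hA hAU
    rw [← Finset.card_union_of_disjoint]
    · exact Finset.card_le_card (Finset.union_subset hTyU hAU)
    · rw [Finset.disjoint_left]
      intro x hx hx'
      rw [hTy, Finset.mem_filter] at hx
      exact hx.2 (hA x hx')
  have hTi_le : Ti.card + 1 ≤ j := by
    have : insert 0 Ti ⊆ Finset.univ.filter fun x : Fin (B + 1) => x.val < j := by
      intro x hx
      rw [Finset.mem_insert] at hx
      rcases hx with rfl | hx
      · simp; omega
      · rw [hTi, Finset.mem_filter] at hx; simp [hx.2]
    have h := Finset.card_le_card this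
    rw [card_lt_eq j hjB, Finset.card_insert_of_notMem] at h
    · exact h
    · intro h; rw [hTi, Finset.mem_filter] at h; exact h0 h.1
  have hpos := hT.card_pos
  have key1 : T.card + j ≤ 2 + U.card → j * (B + T.card) ≤ (1 + U.card) * (B + 1) := by
    intro h
    obtain ⟨s, hs⟩ : ∃ s, T.card = s + 1 := ⟨T.card - 1, by omega⟩
    have h1 : s + j ≤ 1 + U.card := by omega
    have h2 : (s + j) * (B + 1) ≤ (1 + U.card) * (B + 1) := Nat.mul_le_mul_right _ h1
    rw [hs]
    have h3 : j * s ≤ (B + 1) * s := Nat.mul_le_mul_right _ hjB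
    nlinarith
  rcases Nat.lt_or_ge Ti.card 2 with h2 | h2
  · apply key1
    rcases Nat.eq_zero_or_pos Ti.card with h1 | h1
    · -- no small index
      have hA := hdisj (Finset.univ.filter fun l : Fin (B + 1) => 2 ≤ l.val ∧ l.val < j)
        (fun x hx => (Finset.mem_filter.mp hx).2.2) (by
          intro l hl
          obtain ⟨t, ht⟩ := hT
          have ht' : ¬ t.val < j := by
            intro h
            rw [Finset.card_eq_zero, Finset.filter_eq_empty_iff] at h1
            exact h1 ht h
          rw [hU, Finset.mem_biUnion]
          refine ⟨t, ht, ?_⟩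
          simp only [Fidx, if_neg ht']
          simp only [Finset.mem_filter, Finset.mem_univ, true_and] at hl ⊢
          exact Or.inr hl)
      have hc : j ≤ (Finset.univ.filter fun l : Fin (B + 1) => 2 ≤ l.val ∧ l.val < j).card + 2 := by
        have e1 := card_lt_eq (v := B + 1) j hjB
        have e2 := card_lt_eq (v := B + 1) 2 (by omega)
        have : (Finset.univ.filter fun x : Fin (B + 1) => x.val < j) ⊆
          (Finset.univ.filter fun l : Fin (B + 1) => 2 ≤ l.val ∧ l.val < j) ∪
          (Finset.univ.filter fun x : Fin (B + 1) => x.val < 2) := by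
          intro x hx
          simp only [Finset.mem_filter, Finset.mem_univ, true_and, Finset.mem_union] at hx ⊢
          omega
        have := (Finset.card_le_card this).trans (Finset.card_union_le _ _)
        omega
      omega
    · have h3 : Ti.card = 1 := by omega
      obtain ⟨i, hi⟩ := Finset.card_eq_one.mp h3
      have hiT : i ∈ Ti := by rw [hi]; simp
      have hij : i.val < j := (Finset.mem_filter.mp hiT).2
      have hA := hdisj ((Finset.univ.filter fun l : Fin (B + 1) => l.val < j).erase i)
        (fun x hx => (Finset.mem_filter.mp (Finset.mem_of_mem_erase hx)).2) (by
          intro l hl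
          rw [Finset.mem_erase, Finset.mem_filter] at hl
          exact hTiU i hiT l hl.2.2 hl.1)
      rw [Finset.card_erase_of_mem (by simpa using hij), card_lt_eq j hjB] at hA
      omega
  · obtain ⟨i, hi, i', hi', hne⟩ := Finset.one_lt_card.mp h2
    have hA := hdisj (Finset.univ.filter fun l : Fin (B + 1) => l.val < j)
        (fun x hx => (Finset.mem_filter.mp hx).2) (by
          intro l hl
          rw [Finset.mem_filter] at hl
          by_cases hli : l = i
          · exact hTiU i' hi' l hl.2 (by rw [hli]; exact hne)
          · exact hTiU i hi l hl.2 hli)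
    rw [card_lt_eq j hjB] at hA
    have h3 : (1 + (Ty.card + j)) * (B + 1) ≤ (1 + U.card) * (B + 1) :=
      Nat.mul_le_mul_right _ (by omega)
    have h4 : T.card + 1 ≤ Ty.card + j := by omega
    have h5 : j * (T.card + 1) ≤ j * (Ty.card + j) := Nat.mul_le_mul_left _ h4
    have h6 : j * Ty.card ≤ (B + 1) * Ty.card := Nat.mul_le_mul_right _ hjB
    nlinarith

/-- sum over maps of `n^{-|image|}` -/
lemma sum_image_le (n : ℕ) (hn : 1 ≤ n) (N : ℕ) :
    ∑ ζ : Fin N → Fin n, ((n : ℝ)⁻¹) ^ (Finset.univ.image ζ).card ≤ (N.factorial : ℝ) := by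
  have hn0 : (0 : ℝ) < n := by exact_mod_cast hn
  induction N with
  | zero => simp
  | succ N ih =>
    rw [← (Fin.consEquiv (fun _ => Fin n)).sum_comp, Fintype.sum_prod_type_right]
    have h : ∀ ζ : Fin N → Fin n, ∑ z : Fin n,
        ((n : ℝ)⁻¹) ^ (Finset.univ.image (Fin.consEquiv (fun _ => Fin n) (z, ζ))).card
        ≤ (N + 1) * ((n : ℝ)⁻¹) ^ (Finset.univ.image ζ).card := by
      intro ζ
      have e : ∀ z : Fin n, Finset.univ.image (Fin.consEquiv (fun _ => Fin n) (z, ζ)) =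
          insert z (Finset.univ.image ζ) := by
        intro z
        ext w
        simp only [Finset.mem_image, Finset.mem_univ, true_and, Finset.mem_insert]
        rw [Fin.exists_fin_succ]
        simp [Fin.consEquiv, eq_comm]
      simp only [e]
      set I := Finset.univ.image ζ with hI
      have hIc : (I.card : ℝ) ≤ N := by
        have : I.card ≤ N := Finset.card_image_le.trans (by simp)
        exact_mod_cast this
      have h1 : ∀ z : Fin n, ((n : ℝ)⁻¹) ^ (insert z I).card ≤
          (if z ∈ I then ((n : ℝ)⁻¹) ^ I.card else 0) + ((n : ℝ)⁻¹) * ((n : ℝ)⁻¹) ^ I.card := by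
        intro z
        by_cases hz : z ∈ I
        · rw [Finset.insert_eq_of_mem hz, if_pos hz]
          have : 0 ≤ ((n : ℝ)⁻¹) * ((n : ℝ)⁻¹) ^ I.card := by positivity
          linarith
        · rw [Finset.card_insert_of_notMem hz, if_neg hz, pow_succ]
          linarith
      refine (Finset.sum_le_sum fun z _ => h1 z).trans ?_
      rw [Finset.sum_add_distrib, Finset.sum_ite_mem, Finset.univ_inter, Finset.sum_const,
        Finset.sum_const, Finset.card_univ, Fintype.card_fin, nsmul_eq_mul, nsmul_eq_mul,
        ← mul_assoc, mul_inv_cancel₀ hn0.ne', add_mul]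
      gcongr
    refine (Finset.sum_le_sum fun ζ _ => h ζ).trans ?_
    rw [← Finset.mul_sum, Nat.factorial_succ]
    push_cast
    gcongr

end RandomGraphSpectra

namespace RandomGraphSpectra

/-! ### Part 4: the lower bound -/

section Lower

variable {n : ℕ}

/-- The edges required by an embedding of the pattern graph. -/
def edgeImg (j : ℕ) {v : ℕ} (φ : Fin v → Fin n) : Finset (Sym2 (Fin n)) :=
  (EH j v).image fun xy => s(φ xy.1, φ xy.2)

lemma mem_EH {j v : ℕ} {x y : Fin v} : (x, y) ∈ EH j v ↔ HE j x y := by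
  simp [EH]

lemma edgeImg_injOn (j : ℕ) {v : ℕ} (φ : Fin v → Fin n) (hφ : Function.Injective φ) :
    Set.InjOn (fun xy : Fin v × Fin v => s(φ xy.1, φ xy.2)) (EH j v) := by
  rintro ⟨x, y⟩ h ⟨x', y'⟩ h' he
  rw [Finset.mem_coe, mem_EH] at h h'
  simp only [Sym2.eq_iff] at he
  have h1 : x < y := h.1
  have h2 : x' < y' := h'.1
  rcases he with ⟨e1, e2⟩ | ⟨e1, e2⟩
  · rw [hφ e1, hφ e2]
  · have e1 := hφ e1
    have e2 := hφ e2
    subst e1 e2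
    exact absurd h1 (not_lt.mpr h2.le)

lemma edgeImg_card (j : ℕ) {v : ℕ} (φ : Fin v → Fin n) (hφ : Function.Injective φ) :
    (edgeImg j φ).card = (EH j v).card :=
  Finset.card_image_of_injOn (edgeImg_injOn j φ hφ)

/-- `c` dominates the copy. -/
def Dc (j B : ℕ) (φ : Fin (B + 1) → Fin n) (c : Fin n) (ω : Sym2 (Fin n) → Bool) : Prop :=
  c ∉ Set.range φ ∧ ∀ τ : Fin B, ∃ z, z ∉ Set.range φ ∧ (gr ω).Adj z c ∧
    ∀ w ∈ Fidx j (B + 1) τ.succ, (gr ω).Adj z (φ w)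

/-- `c` dominates the copy with witnesses `ζ`. -/
def Dz (j B : ℕ) (φ : Fin (B + 1) → Fin n) (c : Fin n) (ζ : Fin B → Fin n)
    (ω : Sym2 (Fin n) → Bool) : Prop :=
  c ∉ Set.range φ ∧ ∀ τ : Fin B, ζ τ ∉ Set.range φ ∧ (gr ω).Adj (ζ τ) c ∧
    ∀ w ∈ Fidx j (B + 1) τ.succ, (gr ω).Adj (ζ τ) (φ w)

lemma Dz_prob {j B : ℕ} (hj : 2 ≤ j) (hB : j ^ 2 ≤ B + 1) {x p : ℝ} (hx : 1 ≤ x)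
    (hn : (n : ℝ) = x ^ (j * B)) (hp : p = (x ^ (B + 1))⁻¹)
    (φ : Fin (B + 1) → Fin n) (hφ : Function.Injective φ) (c : Fin n) (ζ : Fin B → Fin n) :
    Pr p (Dz j B φ c ζ) ≤ ((n : ℝ)⁻¹) ^ (Finset.univ.image ζ).card * (n : ℝ)⁻¹ := by
  classical
  have hx0 : 0 < x := by linarith
  have hp0 : 0 ≤ p := by rw [hp]; positivity
  have hp1 : p ≤ 1 := by
    rw [hp]; exact inv_le_one_of_one_le₀ (one_le_pow₀ hx)
  by_cases hgood : c ∉ Set.range φ ∧ ∀ τ : Fin B, ζ τ ∉ Set.range φ ∧ ζ τ ≠ c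
  swap
  · have : Pr p (Dz j B φ c ζ) = 0 := by
      have : ∀ ω, ind (Dz j B φ c ζ ω) = 0 := by
        intro ω
        apply ind_false
        rintro ⟨h1, h2⟩
        exact hgood ⟨h1, fun τ => ⟨(h2 τ).1, (h2 τ).2.1.ne⟩⟩
      simp only [Pr, this]
      rw [Ex_const]
    rw [this]
    positivity
  obtain ⟨hc, hz⟩ := hgood
  set T : Fin n → Finset (Fin (B + 1)) := fun z =>
    (Finset.univ.filter fun τ => ζ τ = z).image Fin.succ with hT
  set U : Fin n → Finset (Fin (B + 1)) := fun z => (T z).biUnion (Fidx j (B + 1)) with hU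
  set Q : Finset (Sym2 (Fin n)) := (Finset.univ.image ζ).biUnion fun z =>
    (insert c ((U z).image φ)).image fun w => s(z, w) with hQ
  have hR : ∀ z, ∀ w ∈ insert c ((U z).image φ), w = c ∨ w ∈ Set.range φ := by
    intro z w hw
    rw [Finset.mem_insert, Finset.mem_image] at hw
    rcases hw with h | ⟨u, _, h⟩
    · exact Or.inl h
    · exact Or.inr ⟨u, h⟩
  have hcard : Q.card = ∑ z ∈ Finset.univ.image ζ, (1 + (U z).card) := by
    rw [hQ, Finset.card_biUnion]
    · refine Finset.sum_congr rfl fun z hz' => ?_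
      rw [Finset.card_image_of_injective, Finset.card_insert_of_notMem,
        Finset.card_image_of_injective _ hφ, add_comm]
      · intro h
        rw [Finset.mem_image] at h
        obtain ⟨u, _, h⟩ := h
        exact hc ⟨u, h⟩
      · intro a b hab
        exact Sym2.congr_right.mp hab
    · intro z hz' z' hz'' hne
      rw [Function.onFun, Finset.disjoint_left]
      intro e he he'
      rw [Finset.mem_image] at he he'
      obtain ⟨w, hw, rfl⟩ := he
      obtain ⟨w', hw', he⟩ := he'
      rw [Sym2.eq_iff] at he
      rcases he with ⟨e1, _⟩ | ⟨_, e2⟩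
      · exact hne e1.symm
      · subst e2
        obtain ⟨τ, _, hτ⟩ := Finset.mem_image.mp hz'
        rcases hR _ _ hw' with h | h
        · exact (hz τ).2 (hτ.trans h)
        · exact (hz τ).1 (hτ ▸ h)
  have h1 : Pr p (Dz j B φ c ζ) ≤ p ^ Q.card := by
    rw [← Pr_all_true]
    refine Pr_mono hp0 hp1 fun ω h e he => ?_
    rw [hQ, Finset.mem_biUnion] at he
    obtain ⟨z, hz', he⟩ := he
    obtain ⟨τ, _, rfl⟩ := Finset.mem_image.mp hz'
    obtain ⟨w, hw, rfl⟩ := Finset.mem_image.mp he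
    rw [Finset.mem_insert, Finset.mem_image] at hw
    rcases hw with rfl | ⟨u, hu, rfl⟩
    · exact ((gr_adj _ _ _).mp (h.2 τ).2.1).1
    · rw [hU, Finset.mem_biUnion] at hu
      obtain ⟨t, ht, hu⟩ := hu
      rw [hT, Finset.mem_image] at ht
      obtain ⟨τ', hτ', rfl⟩ := ht
      have : ζ τ' = ζ τ := (Finset.mem_filter.mp hτ').2
      rw [← this]
      exact ((gr_adj _ _ _).mp ((h.2 τ').2.2 u hu)).1
  refine h1.trans ?_
  rw [hcard, ← Finset.prod_pow_eq_pow_sum]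
  have h2 : ∀ z ∈ Finset.univ.image ζ, p ^ (1 + (U z).card) ≤
      (n : ℝ)⁻¹ * ((x ^ j)⁻¹) ^ (Finset.univ.filter fun τ => ζ τ = z).card := by
    intro z hz'
    have hTc : (T z).card = (Finset.univ.filter fun τ => ζ τ = z).card :=
      Finset.card_image_of_injective _ (Fin.succ_injective _)
    have hne : (T z).Nonempty := by
      obtain ⟨τ, _, hτ⟩ := Finset.mem_image.mp hz'
      exact ⟨τ.succ, Finset.mem_image_of_mem _ (by simpa using hτ)⟩
    have h0 : 0 ∉ T z := by
      intro h
      obtain ⟨τ, _, hτ⟩ := Finset.mem_image.mp h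
      exact Fin.succ_ne_zero _ hτ
    have key := Fidx_ineq j B hj hB (T z) hne h0
    rw [← hTc, hp, hn, inv_pow, inv_pow, ← mul_inv, ← pow_mul, ← pow_mul, ← pow_add]
    refine inv_anti₀ (by positivity) (pow_le_pow_right₀ hx ?_)
    change _ ≤ (B + 1) * (1 + ((T z).biUnion (Fidx j (B + 1))).card)
    nlinarith
  refine (Finset.prod_le_prod (fun z _ => by positivity) h2).trans ?_
  rw [Finset.prod_mul_distrib, Finset.prod_const, Finset.prod_pow_eq_pow_sum]
  have h3 : ∑ z ∈ Finset.univ.image ζ, (Finset.univ.filter fun τ => ζ τ = z).card = B := by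
    rw [← Finset.card_eq_sum_card_image]; simp
  rw [h3, hn, inv_pow (x ^ j) B, ← pow_mul x j B]

lemma Dc_prob {j B : ℕ} (hj : 2 ≤ j) (hB : j ^ 2 ≤ B + 1) {x p : ℝ} (hx : 1 ≤ x) (hn1 : 1 ≤ n)
    (hn : (n : ℝ) = x ^ (j * B)) (hp : p = (x ^ (B + 1))⁻¹)
    (φ : Fin (B + 1) → Fin n) (hφ : Function.Injective φ) (c : Fin n) :
    Pr p (Dc j B φ c) ≤ (B.factorial : ℝ) / n := by
  have hx0 : 0 < x := by linarith
  have hp0 : 0 ≤ p := by rw [hp]; positivity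
  have hp1 : p ≤ 1 := by
    rw [hp]; exact inv_le_one_of_one_le₀ (one_le_pow₀ hx)
  calc Pr p (Dc j B φ c) ≤ Pr p (fun ω => ∃ ζ ∈ (Finset.univ : Finset (Fin B → Fin n)),
        Dz j B φ c ζ ω) := by
        refine Pr_mono hp0 hp1 fun ω h => ?_
        choose ζ hζ using h.2
        exact ⟨ζ, Finset.mem_univ _, h.1, hζ⟩
    _ ≤ ∑ ζ : Fin B → Fin n, Pr p (Dz j B φ c ζ) := Pr_exists_le hp0 hp1 _ _
    _ ≤ ∑ ζ : Fin B → Fin n, ((n : ℝ)⁻¹) ^ (Finset.univ.image ζ).card * (n : ℝ)⁻¹ :=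
        Finset.sum_le_sum fun ζ _ => Dz_prob hj hB hx hn hp φ hφ c ζ
    _ ≤ (B.factorial : ℝ) / n := by
        rw [← Finset.sum_mul, div_eq_mul_inv]
        exact mul_le_mul_of_nonneg_right (sum_image_le n hn1 B) (by positivity)

lemma gr_mono {ω ω' : Sym2 (Fin n) → Bool} (h : ω ≤ ω') {a b : Fin n} (hab : (gr ω).Adj a b) :
    (gr ω').Adj a b := by
  rw [gr_adj] at *
  refine ⟨?_, hab.2⟩
  have := h s(a, b)
  rw [hab.1] at this
  revert this
  cases ω' s(a, b) <;> simp

lemma Dc_mono (j B : ℕ) (φ : Fin (B + 1) → Fin n) (c : Fin n) : Monotone (Dc j B φ c) := by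
  intro ω ω' h hD
  refine ⟨hD.1, fun τ => ?_⟩
  obtain ⟨z, h1, h2, h3⟩ := hD.2 τ
  exact ⟨z, h1, gr_mono h h2, fun w hw => gr_mono h (h3 w hw)⟩

lemma notD_prob {j B : ℕ} (hj : 2 ≤ j) (hB : j ^ 2 ≤ B + 1) {x p : ℝ} (hx : 1 ≤ x) (hn1 : 1 ≤ n)
    (hn : (n : ℝ) = x ^ (j * B)) (hp : p = (x ^ (B + 1))⁻¹) (hK : (B.factorial : ℝ) ≤ n)
    (φ : Fin (B + 1) → Fin n) (hφ : Function.Injective φ) :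
    (1 + (-(B.factorial : ℝ)) / n) ^ n ≤ Pr p (fun ω => ¬ ∃ c, Dc j B φ c ω) := by
  have hx0 : 0 < x := by linarith
  have hp0 : 0 ≤ p := by rw [hp]; positivity
  have hp1 : p ≤ 1 := by
    rw [hp]; exact inv_le_one_of_one_le₀ (one_le_pow₀ hx)
  have hn0 : (0 : ℝ) < n := by exact_mod_cast hn1
  calc (1 + (-(B.factorial : ℝ)) / n) ^ n = ∏ c : Fin n, (1 + (-(B.factorial : ℝ)) / n) := by
        simp
    _ ≤ ∏ c : Fin n, Pr p (fun ω => ¬ Dc j B φ c ω) := by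
        refine Finset.prod_le_prod (fun c _ => ?_) (fun c _ => ?_)
        · rw [neg_div]
          have : (B.factorial : ℝ) / n ≤ 1 := (div_le_one hn0).mpr hK
          linarith
        · rw [Pr_not, neg_div]
          have := Dc_prob hj hB hx hn1 hn hp φ hφ c
          linarith
    _ ≤ Pr p (fun ω => ∀ c ∈ (Finset.univ : Finset (Fin n)), ¬ Dc j B φ c ω) :=
        harris_forall hp0 hp1 _ (fun c => Dc_mono j B φ c)
    _ = _ := Pr_congr fun ω => by simp

/-- The event that `φ` is an undominated copy. -/
def GoodC (j B : ℕ) (φ : Fin (B + 1) → Fin n) (ω : Sym2 (Fin n) → Bool) : Prop :=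
  (∀ e ∈ edgeImg j φ, ω e = true) ∧ ¬ ∃ c, Dc j B φ c ω

lemma GoodC_prob (j B : ℕ) (p : ℝ) (φ : Fin (B + 1) → Fin n) (hφ : Function.Injective φ) :
    Pr p (GoodC j B φ) = p ^ (EH j (B + 1)).card * Pr p (fun ω => ¬ ∃ c, Dc j B φ c ω) := by
  rw [← edgeImg_card j φ hφ, ← Pr_all_true]
  refine Pr_indep p {e | ∀ w ∈ e, w ∈ Set.range φ} ?_ ?_
  · intro ω ω' h
    refine propext (forall₂_congr fun e he => ?_)
    rw [h e]
    intro w hw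
    obtain ⟨⟨x, y⟩, _, rfl⟩ := Finset.mem_image.mp he
    rw [Sym2.mem_iff] at hw
    rcases hw with rfl | rfl <;> simp
  · intro ω ω' h
    have hadj : ∀ z b, z ∉ Set.range φ → ((gr ω).Adj z b ↔ (gr ω').Adj z b) := by
      intro z b hz
      rw [gr_adj, gr_adj, h s(z, b)]
      intro hmem
      exact hz (hmem z (by simp))
    refine propext (not_congr (exists_congr fun c => and_congr_right fun _ =>
      forall_congr' fun τ => exists_congr fun z => and_congr_right fun hz => ?_))
    rw [hadj z c hz]
    exact and_congr_right fun _ => forall₂_congr fun w _ => hadj z _ hz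

open Classical in
/-- injective maps -/
noncomputable def Inj (v n : ℕ) : Finset (Fin v → Fin n) :=
  Finset.univ.filter fun φ => Function.Injective φ

lemma Inj_card (v n : ℕ) : (Inj v n).card = n.descFactorial v := by
  classical
  rw [Inj, ← Fintype.card_subtype, Fintype.card_congr (Equiv.subtypeInjectiveEquivEmbedding _ _),
    Fintype.card_embedding_eq]
  simp

/-- number of undominated copies -/
noncomputable def Xc (j B : ℕ) (ω : Sym2 (Fin n) → Bool) : ℝ :=
  ∑ φ ∈ Inj (B + 1) n, ind (GoodC j B φ ω)

lemma scale {j B e : ℕ} (he : e = j * B) {x p : ℝ} (hx : 1 ≤ x)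
    (hn : (n : ℝ) = x ^ (j * B)) (hp : p = (x ^ (B + 1))⁻¹) :
    (n : ℝ) ^ (B + 1) * p ^ e = 1 := by
  have hx0 : 0 < x := by linarith
  rw [hn, hp, inv_pow, ← pow_mul, ← pow_mul, he, mul_comm (B + 1) (j * B)]
  exact mul_inv_cancel₀ (by positivity)

lemma EH_card' {j B : ℕ} (hj : 2 ≤ j) (hB : j ^ 2 ≤ B + 1) : (EH j (B + 1)).card = j * B := by
  have := EH_card j (B + 1) (by nlinarith) (by omega)
  nlinarith

lemma Ex_Xc {j B : ℕ} (hj : 2 ≤ j) (hB : j ^ 2 ≤ B + 1) {x p δ : ℝ} (hx : 1 ≤ x)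
    (hn1 : 2 * (B + 1) ≤ n)
    (hn : (n : ℝ) = x ^ (j * B)) (hp : p = (x ^ (B + 1))⁻¹) (hK : (B.factorial : ℝ) ≤ n)
    (hδ0 : 0 ≤ δ) (hδ : δ ≤ (1 + (-(B.factorial : ℝ)) / n) ^ n) :
    (1 / 2) ^ (B + 1) * δ ≤ Ex p (Xc (n := n) j B) := by
  have hx0 : 0 < x := by linarith
  have hp0 : 0 ≤ p := by rw [hp]; positivity
  have h1 : Ex p (Xc (n := n) j B) = ∑ φ ∈ Inj (B + 1) n, Pr p (GoodC j B φ) := by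
    unfold Xc Pr
    rw [Ex_sum]
  have h2 : (Inj (B + 1) n).card * (p ^ (j * B) * δ) ≤ Ex p (Xc (n := n) j B) := by
    rw [h1, ← nsmul_eq_mul]
    refine Finset.card_nsmul_le_sum _ _ _ fun φ hφ => ?_
    have hφ' : Function.Injective φ := by simpa [Inj] using hφ
    rw [GoodC_prob j B p φ hφ', EH_card' hj hB]
    exact mul_le_mul_of_nonneg_left
      (hδ.trans (notD_prob hj hB hx (by omega) hn hp hK φ hφ')) (by positivity)
  refine le_trans ?_ h2
  have h3 : ((n : ℝ) / 2) ^ (B + 1) ≤ (Inj (B + 1) n).card := by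
    rw [Inj_card]
    have h4 := Nat.pow_sub_le_descFactorial n (B + 1)
    have h5 : ((n + 1 - (B + 1) : ℕ) : ℝ) ^ (B + 1) ≤ n.descFactorial (B + 1) := by
      exact_mod_cast h4
    refine le_trans (pow_le_pow_left₀ (by positivity) ?_ _) h5
    rw [Nat.cast_sub (by omega)]
    have : (2 * (B + 1) : ℝ) ≤ n := by exact_mod_cast hn1
    push_cast
    linarith
  have h6 := scale (e := j * B) rfl hx hn hp
  calc (1 / 2) ^ (B + 1) * δ = ((n : ℝ) / 2) ^ (B + 1) * (p ^ (j * B) * δ) := by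
        have : ((n : ℝ) / 2) ^ (B + 1) * (p ^ (j * B) * δ) =
            ((n : ℝ) ^ (B + 1) * p ^ (j * B)) * ((1 / 2) ^ (B + 1) * δ) := by
          rw [div_eq_mul_one_div, mul_pow]; ring
        rw [this, h6, one_mul]
    _ ≤ _ := mul_le_mul_of_nonneg_right h3 (by positivity)

lemma inter_card (j : ℕ) {v : ℕ} (φ φ' : Fin v → Fin n) (S : Finset (Fin v))
    (hS : ∀ x, φ' x ∈ Set.range φ → x ∈ S) :
    (edgeImg j φ ∩ edgeImg j φ').card ≤ (EHin j v S).card := by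
  have : edgeImg j φ ∩ edgeImg j φ' ⊆ (EHin j v S).image fun xy => s(φ' xy.1, φ' xy.2) := by
    intro e he
    rw [Finset.mem_inter] at he
    obtain ⟨h1, h2⟩ := he
    obtain ⟨⟨x, y⟩, hxy, rfl⟩ := Finset.mem_image.mp h2
    obtain ⟨⟨a, b⟩, hab, he⟩ := Finset.mem_image.mp h1
    refine Finset.mem_image_of_mem _ ?_
    rw [EHin, Finset.mem_filter]
    refine ⟨hxy, hS _ ?_, hS _ ?_⟩ <;> simp only [Sym2.eq_iff] at he ⊢
    · rcases he with ⟨e1, e2⟩ | ⟨e1, e2⟩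
      · exact ⟨a, e1⟩
      · exact ⟨b, e2⟩
    · rcases he with ⟨e1, e2⟩ | ⟨e1, e2⟩
      · exact ⟨b, e2⟩
      · exact ⟨a, e1⟩
  exact (Finset.card_le_card this).trans Finset.card_image_le

open Classical in
lemma pair_bound {j B : ℕ} (hj : 2 ≤ j) (hB : j ^ 2 ≤ B + 1) {x p : ℝ} (hx : 1 ≤ x)
    (hn : (n : ℝ) = x ^ (j * B)) (hp : p = (x ^ (B + 1))⁻¹)
    (φ φ' : Fin (B + 1) → Fin n) (hφ : Function.Injective φ) (hφ' : Function.Injective φ') :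
    p ^ (edgeImg j φ ∪ edgeImg j φ').card ≤ p ^ (2 * (j * B)) *
      ∏ y : Fin (B + 1), (if φ' y ∈ Set.range φ then (n : ℝ) else 1) := by
  have hx0 : 0 < x := by linarith
  set S : Finset (Fin (B + 1)) := Finset.univ.filter fun y => φ' y ∈ Set.range φ with hS
  have h1 := Finset.card_union_add_card_inter (edgeImg j φ) (edgeImg j φ')
  rw [edgeImg_card j φ hφ, edgeImg_card j φ' hφ', EH_card' hj hB] at h1
  have h2 := inter_card j φ φ' S (fun y hy => by simpa [hS] using hy)
  have h3 : (B + 1) * (edgeImg j φ ∩ edgeImg j φ').card ≤ j * B * S.card := by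
    refine (Nat.mul_le_mul_left _ h2).trans ?_
    rcases S.eq_empty_or_nonempty with h | h
    · rw [h]; simp [EHin]
    · have h4 := EHin_card j (B + 1) S h
      have h5 : S.card ≤ B + 1 := (Finset.card_le_univ S).trans (by simp)
      obtain ⟨s, hs⟩ : ∃ s, S.card = s + 1 := ⟨S.card - 1, by have := h.card_pos; omega⟩
      rw [hs] at h4 h5 ⊢
      have h6 : (EHin j (B + 1) S).card ≤ j * s := by nlinarith
      calc _ ≤ (B + 1) * (j * s) := Nat.mul_le_mul_left _ h6
        _ = j * (B * s + s) := by ring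
        _ ≤ j * (B * s + B) := Nat.mul_le_mul_left _ (by omega)
        _ = _ := by ring
  have h7 : ∏ y : Fin (B + 1), (if φ' y ∈ Set.range φ then (n : ℝ) else 1) = (n : ℝ) ^ S.card := by
    rw [← Finset.prod_filter, Finset.prod_const]
  rw [h7, hn, ← pow_mul, show 2 * (j * B) = (edgeImg j φ ∪ edgeImg j φ').card +
    (edgeImg j φ ∩ edgeImg j φ').card by omega, pow_add, mul_assoc]
  have hp0 : 0 < p := by rw [hp]; positivity
  refine le_mul_of_one_le_right (by positivity) ?_
  rw [hp, inv_pow, ← pow_mul, inv_mul_eq_div, one_le_div (by positivity)]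
  exact pow_le_pow_right₀ hx h3

lemma Ex_Xc_sq {j B : ℕ} (hj : 2 ≤ j) (hB : j ^ 2 ≤ B + 1) {x p : ℝ} (hx : 1 ≤ x)
    (hn : (n : ℝ) = x ^ (j * B)) (hp : p = (x ^ (B + 1))⁻¹) :
    Ex p (fun ω => (Xc (n := n) j B ω) ^ 2) ≤ ((B : ℝ) + 2) ^ (B + 1) := by
  classical
  have hx0 : 0 < x := by linarith
  have hp0 : 0 ≤ p := by rw [hp]; positivity
  have hp1 : p ≤ 1 := by
    rw [hp]; exact inv_le_one_of_one_le₀ (one_le_pow₀ hx)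
  have e1 : Ex p (fun ω => (Xc (n := n) j B ω) ^ 2) = ∑ φ ∈ Inj (B + 1) n, ∑ φ' ∈ Inj (B + 1) n,
      Ex p (fun ω => ind (GoodC j B φ ω) * ind (GoodC j B φ' ω)) := by
    simp only [Xc, sq, Finset.sum_mul_sum]
    rw [Ex_sum]
    refine Finset.sum_congr rfl fun φ _ => ?_
    rw [Ex_sum]
  rw [e1]
  have h1 : ∀ φ ∈ Inj (B + 1) n, ∀ φ' ∈ Inj (B + 1) n,
      Ex p (fun ω => ind (GoodC j B φ ω) * ind (GoodC j B φ' ω)) ≤ p ^ (2 * (j * B)) *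
      ∏ y : Fin (B + 1), (if φ' y ∈ Set.range φ then (n : ℝ) else 1) := by
    intro φ hφ φ' hφ'
    simp only [Inj, Finset.mem_filter, Finset.mem_univ, true_and] at hφ hφ'
    refine le_trans ?_ (pair_bound hj hB hx hn hp φ φ' hφ hφ')
    rw [← Pr_all_true]
    refine Ex_mono hp0 hp1 fun ω => ?_
    rw [← ind_and]
    refine ind_mono fun h e he => ?_
    rcases Finset.mem_union.mp he with he | he
    · exact h.1.1 e he
    · exact h.2.1 e he
  have h2 : ∀ φ ∈ Inj (B + 1) n, ∑ φ' ∈ Inj (B + 1) n,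
      Ex p (fun ω => ind (GoodC j B φ ω) * ind (GoodC j B φ' ω)) ≤
      p ^ (2 * (j * B)) * ((n : ℝ) * (B + 2)) ^ (B + 1) := by
    intro φ hφ
    refine (Finset.sum_le_sum (h1 φ hφ)).trans ?_
    rw [← Finset.mul_sum]
    refine mul_le_mul_of_nonneg_left ?_ (by positivity)
    calc _ ≤ ∑ φ' : Fin (B + 1) → Fin n,
            ∏ y : Fin (B + 1), (if φ' y ∈ Set.range φ then (n : ℝ) else 1) := by
          refine Finset.sum_le_sum_of_subset_of_nonneg (Finset.subset_univ _) fun φ' _ _ => ?_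
          exact Finset.prod_nonneg fun y _ => by split_ifs <;> positivity
      _ = ∏ y : Fin (B + 1), ∑ u : Fin n, (if u ∈ Set.range φ then (n : ℝ) else 1) := by
          rw [Finset.prod_univ_sum, Fintype.piFinset_univ]
      _ = (∑ u : Fin n, (if u ∈ Set.range φ then (n : ℝ) else 1)) ^ (B + 1) := by simp
      _ ≤ _ := by
          refine pow_le_pow_left₀ (Finset.sum_nonneg fun y _ => by split_ifs <;> positivity) ?_ _
          calc _ ≤ ∑ u : Fin n, ((if u ∈ Finset.univ.image φ then (n : ℝ) else 0) + 1) := by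
                refine Finset.sum_le_sum fun u _ => ?_
                have : u ∈ Finset.univ.image φ ↔ u ∈ Set.range φ := by simp
                by_cases hu : u ∈ Set.range φ
                · rw [if_pos hu, if_pos (this.mpr hu)]; linarith
                · rw [if_neg hu, if_neg (fun h => hu (this.mp h))]; linarith
            _ ≤ _ := by
                rw [Finset.sum_add_distrib, Finset.sum_ite_mem, Finset.univ_inter,
                  Finset.sum_const, nsmul_eq_mul, Finset.sum_const, Finset.card_univ,
                  Fintype.card_fin, nsmul_eq_mul]
                have : (Finset.univ.image φ).card ≤ B + 1 := Finset.card_image_le.trans (by simp)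
                have : ((Finset.univ.image φ).card : ℝ) ≤ B + 1 := by exact_mod_cast this
                have hn0 : (0 : ℝ) ≤ n := by positivity
                nlinarith
  refine (Finset.sum_le_sum h2).trans ?_
  rw [Finset.sum_const, nsmul_eq_mul]
  have h3 : ((Inj (B + 1) n).card : ℝ) ≤ (n : ℝ) ^ (B + 1) := by
    rw [Inj_card]
    exact_mod_cast Nat.descFactorial_le_pow n (B + 1)
  have h6 := scale (e := j * B) rfl hx hn hp
  calc _ ≤ (n : ℝ) ^ (B + 1) * (p ^ (2 * (j * B)) * ((n : ℝ) * (B + 2)) ^ (B + 1)) :=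
        mul_le_mul_of_nonneg_right h3 (by positivity)
    _ = ((n : ℝ) ^ (B + 1) * p ^ (j * B)) * ((n : ℝ) ^ (B + 1) * p ^ (j * B)) *
        ((B : ℝ) + 2) ^ (B + 1) := by rw [mul_pow]; ring
    _ = _ := by rw [h6]; ring

lemma GoodC_LProp {q B : ℕ} (hB : (q + 2) ^ 2 ≤ B + 1) (φ : Fin (B + 1) → Fin n)
    (hφ : Function.Injective φ) (ω : Sym2 (Fin n) → Bool) (h : GoodC (q + 2) B φ ω) :
    LProp q (gr ω) := by
  have hB2 : 2 * (q + 2) ≤ B + 1 := by nlinarith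
  have hE : ∀ x y : Fin (B + 1), x.val < y.val → (x.val < q + 2 ∨ y.val < 2 * (q + 2)) →
      (gr ω).Adj (φ x) (φ y) := by
    intro x y h1 h2
    rw [gr_adj]
    refine ⟨h.1 _ (Finset.mem_image_of_mem (fun xy : Fin (B + 1) × Fin (B + 1) =>
      s(φ xy.1, φ xy.2)) (mem_EH.mpr ⟨h1, h2⟩)), fun e => ?_⟩
    rw [hφ e] at h1
    exact lt_irrefl _ h1
  have hE' : ∀ x y : Fin (B + 1), x ≠ y → (x.val < q + 2 ∧ y.val < 2 * (q + 2) ∨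
      y.val < q + 2 ∨ (x.val < 2 * (q + 2) ∧ y.val < 2 * (q + 2))) →
      (gr ω).Adj (φ x) (φ y) := by
    intro x y hne h1
    have : x.val ≠ y.val := fun e => hne (Fin.ext e)
    rcases Nat.lt_or_gt_of_ne this with h2 | h2
    · exact hE x y h2 (by omega)
    · exact (hE y x h2 (by omega)).symm
  let a : Fin (q + 2) → Fin n := fun i => φ ⟨i.val, by omega⟩
  refine ⟨a, ⟨fun i => φ ⟨i.val + (q + 2), by omega⟩, ?_, ?_, ?_⟩, ?_⟩
  · intro i l hil
    have : i.val ≠ l.val := fun e => hil (Fin.ext e)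
    exact hE' _ _ (by simpa using this) (by simp only; omega)
  · intro i l
    exact hE _ _ (by simp only; omega) (by simp only; omega)
  · intro i l hil
    have : i.val ≠ l.val := fun e => hil (Fin.ext e)
    exact hE' _ _ (by simpa using this) (by simp only; omega)
  · rintro ⟨c, hca, hc0, hcu, hcy⟩
    refine h.2 ⟨c, ?_, ?_⟩
    · rintro ⟨x, rfl⟩
      by_cases hx : x.val < q + 2
      · exact hca ⟨x.val, hx⟩ rfl
      · exact hc0 (hE ⟨0, by omega⟩ x (by simp only; omega) (by simp only; omega)).symm
    · intro τ
      by_cases hτ : τ.val + 1 < q + 2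
      · obtain ⟨u, h1, h2, h3, h4⟩ := hcu ⟨τ.val + 1, hτ⟩ (by
          intro e; have := congrArg Fin.val e; simp at this)
        refine ⟨u, ?_, h1, ?_⟩
        · rintro ⟨x, rfl⟩
          by_cases hx : x.val < q + 2
          · exact h4 ⟨x.val, hx⟩ rfl
          · exact h3 (hE ⟨τ.val + 1, by omega⟩ x (by simp only; omega) (by simp only; omega)).symm
        · intro w hw
          simp only [Fidx, Fin.val_succ, if_pos hτ, Finset.mem_filter, Finset.mem_univ,
            true_and] at hw
          exact h2 ⟨w.val, hw.1⟩ (fun e => hw.2 (Fin.ext (by simpa using congrArg Fin.val e)))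
      · obtain ⟨z, h1, h2, h3, h4, h5⟩ := hcy (φ τ.succ) (fun i =>
          hE _ _ (by simp only [Fin.val_succ]; omega) (by simp only; omega))
        refine ⟨z, ?_, h1, ?_⟩
        · rintro ⟨x, rfl⟩
          by_cases hx : x.val < q + 2
          · exact h5 ⟨x.val, hx⟩ rfl
          · exact h4 (hE ⟨0, by omega⟩ x (by simp only; omega) (by simp only; omega)).symm
        · intro w hw
          simp only [Fidx, Fin.val_succ, if_neg hτ, Finset.mem_filter, Finset.mem_univ,
            true_and] at hw
          rcases hw with rfl | ⟨hw1, hw2⟩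
          · exact h2
          · refine h3 ⟨w.val, hw2⟩ (fun e => ?_) (fun e => ?_)
            · have : w.val = 0 := congrArg Fin.val e
              omega
            · have : w.val = 1 := congrArg Fin.val e
              omega

end Lower

lemma lower_bound (q B : ℕ) (hB : (q + 2) ^ 2 ≤ B + 1) :
    ∃ δ : ℝ, 0 < δ ∧ ∀ᶠ n : ℕ in atTop, ∀ x p : ℝ, 1 ≤ x → (n : ℝ) = x ^ ((q + 2) * B) →
      p = (x ^ (B + 1))⁻¹ → δ ≤ Pr p (fun ω : Sym2 (Fin n) → Bool => LProp q (gr ω)) := by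
  set δ₀ := Real.exp (-(B.factorial : ℝ)) / 2 with hδ₀
  have hδ₀' : 0 < δ₀ := by positivity
  have hpos : 0 < ((B : ℝ) + 2) ^ (B + 1) := by positivity
  refine ⟨((1 / 2) ^ (B + 1) * δ₀) ^ 2 / ((B : ℝ) + 2) ^ (B + 1), by positivity, ?_⟩
  have ht := Real.tendsto_one_add_div_pow_exp (-(B.factorial : ℝ))
  have h1 := ht.eventually (eventually_ge_nhds (b := δ₀) (by
    rw [hδ₀]; exact half_lt_self (Real.exp_pos _)))
  filter_upwards [h1, eventually_ge_atTop (2 * (B + 1)), eventually_ge_atTop B.factorial]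
    with n hn1 hn2 hn3 x p hx hn hp
  have hp0 : 0 ≤ p := by rw [hp]; positivity
  have hp1 : p ≤ 1 := by
    rw [hp]; exact inv_le_one_of_one_le₀ (one_le_pow₀ hx)
  have h2 := Ex_Xc (j := q + 2) (by omega) hB hx hn2 hn hp (by exact_mod_cast hn3) hδ₀'.le hn1
  have h3 := Ex_Xc_sq (j := q + 2) (by omega) hB hx hn hp
  have h4 := second_moment hp0 hp1 (Xc (n := n) (q + 2) B)
  have h5 : Pr p (fun ω => Xc (n := n) (q + 2) B ω ≠ 0) ≤
      Pr p (fun ω : Sym2 (Fin n) → Bool => LProp q (gr ω)) := by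
    refine Pr_mono hp0 hp1 fun ω h => ?_
    obtain ⟨φ, hφ, h⟩ := Finset.exists_ne_zero_of_sum_ne_zero h
    have hφ' : Function.Injective φ := by simpa [Inj] using hφ
    have hG : GoodC (q + 2) B φ ω := by
      by_contra hG
      exact h (ind_false hG)
    exact GoodC_LProp hB φ hφ' ω hG
  rw [div_le_iff₀ hpos]
  calc _ ≤ (Ex p (Xc (n := n) (q + 2) B)) ^ 2 := pow_le_pow_left₀ (by positivity) h2 _
    _ ≤ _ := h4
    _ ≤ Pr p (fun ω => Xc (n := n) (q + 2) B ω ≠ 0) * ((B : ℝ) + 2) ^ (B + 1) :=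
        mul_le_mul_of_nonneg_left h3 (Pr_nonneg hp0 hp1 _)
    _ ≤ _ := mul_le_mul_of_nonneg_right h5 hpos.le

end RandomGraphSpectra

namespace RandomGraphSpectra

/-! ### Part 5: existence of dominating vertices -/

section Exist

variable {E : Type*} [Fintype E] [DecidableEq E]

lemma Pr_all_false (p : ℝ) (T : Finset E) :
    Pr p (fun ω : E → Bool => ∀ e ∈ T, ω e = false) = (1 - p) ^ T.card := by
  have h1 : ∀ ω : E → Bool, ind (∀ e ∈ T, ω e = false)
      = ∏ e, (fun e b => if e ∈ T then ind (b = false) else 1) e (ω e) := by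
    intro ω
    rw [ind_forall]
    simp only
    rw [Finset.prod_ite_mem, Finset.univ_inter]
  simp only [Pr, h1]
  refine (Ex_prod p (fun (e : E) (b : Bool) => if e ∈ T then ind (b = false) else 1)).trans ?_
  have : ∀ e, (p * (if e ∈ T then ind (true = false) else 1)
      + (1 - p) * (if e ∈ T then ind (false = false) else 1)) = if e ∈ T then 1 - p else 1 := by
    intro e
    split_ifs <;> simp [ind]
  refine (Finset.prod_congr rfl fun e _ => this e).trans ?_
  rw [Finset.prod_ite_mem, Finset.univ_inter, Finset.prod_const]

lemma Pr_true_false (p : ℝ) (T : Finset E) (b : E) (hb : b ∉ T) :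
    Pr p (fun ω : E → Bool => (∀ e ∈ T, ω e = true) ∧ ω b = false) = p ^ T.card * (1 - p) := by
  have h := Pr_indep p (T : Set E) (A := fun ω : E → Bool => ∀ e ∈ T, ω e = true)
    (B := fun ω => ∀ e ∈ ({b} : Finset E), ω e = false) ?_ ?_
  · rw [Pr_all_true, Pr_all_false] at h
    simpa using h
  · intro ω ω' h
    exact propext (forall₂_congr fun e he => by rw [h e he])
  · intro ω ω' h
    refine propext (forall₂_congr fun e he => ?_)
    rw [Finset.mem_singleton] at he
    subst he
    rw [h e (by simpa using hb)]

end Exist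

section Exist2

variable {n N s : ℕ}

/-- vertex `z` is a suitable witness -/
def GoodZ (F : Finset (Fin n)) (b z : Fin n) (ω : Sym2 (Fin n) → Bool) : Prop :=
  (∀ w ∈ F, ω s(z, w) = true) ∧ ω s(z, b) = false

open Classical in
/-- set of good indices -/
noncomputable def goodSet (F : Fin N → Finset (Fin n)) (b : Fin N → Fin n)
    (zz : Fin N → Fin s → Fin n) (ω : Sym2 (Fin n) → Bool) (τ : Fin N) : Finset (Fin s) :=
  Finset.univ.filter fun i => GoodZ (F τ) (b τ) (zz τ i) ω

/-- vertex `c` is joined to witnesses from `A` -/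
def GoodCc (b0 : Fin n) (zz : Fin N → Fin s → Fin n) (A : Fin N → Finset (Fin s)) (c : Fin n)
    (ω : Sym2 (Fin n) → Bool) : Prop :=
  ω s(c, b0) = false ∧ ∀ τ, ∃ i ∈ A τ, ω s(zz τ i, c) = true

lemma GoodZ_prob (p : ℝ) (F : Finset (Fin n)) (b z : Fin n) (hb : b ∉ F) :
    Pr p (GoodZ F b z) = p ^ F.card * (1 - p) := by
  have hinj : Function.Injective fun w => s(z, w) := fun a b hab => Sym2.congr_right.mp hab
  have h := Pr_true_false p (F.image fun w => s(z, w)) s(z, b) (by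
    intro h
    obtain ⟨w, hw, e⟩ := Finset.mem_image.mp h
    exact hb (hinj e ▸ hw))
  rw [Finset.card_image_of_injective _ hinj] at h
  rw [← h]
  exact Pr_congr fun ω => by simp [GoodZ]

lemma small_set_prob {p : ℝ} (hp0 : 0 ≤ p) (hp1 : p ≤ 1) (R F : Finset (Fin n)) (b : Fin n)
    (hF : F ⊆ R) (hbR : b ∈ R) (hb : b ∉ F) (z : Fin s → Fin n) (hz : Function.Injective z)
    (hzR : ∀ i, z i ∉ R) (K : ℕ) :
    Pr p (fun ω => (goodSet (fun _ : Fin 1 => F) (fun _ => b) (fun _ => z) ω 0).card < K) ≤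
      2 ^ K * (1 - p ^ F.card * (1 - p) / 2) ^ s := by
  classical
  have h1 : Ex p (fun ω => ∏ i : Fin s, (1 - ind (GoodZ F b (z i) ω) / 2)) =
      (1 - p ^ F.card * (1 - p) / 2) ^ s := by
    rw [Ex_prod_indep p Finset.univ (fun i ω => 1 - ind (GoodZ F b (z i) ω) / 2)
      (fun i => {e | z i ∈ e ∧ ∀ i', i' ≠ i → z i' ∉ e})]
    · rw [Finset.prod_congr rfl (g := fun _ => (1 - p ^ F.card * (1 - p) / 2))]
      · simp
      · intro i _
        rw [Ex_sub, Ex_one]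
        have := GoodZ_prob p F b (z i) hb
        rw [← this, Pr, div_eq_inv_mul, ← Ex_const_mul]
        congr 2
        funext ω
        ring
    · intro i _ ω ω' h
      have hbit : ∀ w ∈ R, ω s(z i, w) = ω' s(z i, w) := by
        intro w hw
        refine h _ ⟨by simp, fun i' hi' hmem => ?_⟩
        rw [Sym2.mem_iff] at hmem
        rcases hmem with e | e
        · exact hi' (hz e)
        · exact hzR i' (e ▸ hw)
      have : GoodZ F b (z i) ω ↔ GoodZ F b (z i) ω' := by
        unfold GoodZ
        rw [hbit b hbR]
        exact and_congr_left fun _ => forall₂_congr fun w hw => by rw [hbit w (hF hw)]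
      simp only [ind_congr this]
    · intro i _ i' _ hne
      rw [Set.disjoint_left]
      rintro e ⟨h1, _⟩ ⟨_, h2⟩
      exact h2 i hne h1
  rw [← h1, ← Ex_const_mul]
  refine Ex_mono hp0 hp1 fun ω => ?_
  have h2 : ∏ i : Fin s, (1 - ind (GoodZ F b (z i) ω) / 2) =
      (1 / 2) ^ (goodSet (fun _ : Fin 1 => F) (fun _ => b) (fun _ => z) ω 0).card := by
    rw [goodSet, ← Finset.prod_const, Finset.prod_filter]
    refine Finset.prod_congr rfl fun i _ => ?_
    split_ifs with h
    · rw [ind_true h]; norm_num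
    · rw [ind_false h]; norm_num
  rw [h2]
  by_cases h : (goodSet (fun _ : Fin 1 => F) (fun _ => b) (fun _ => z) ω 0).card < K
  · rw [ind_true h]
    calc (1 : ℝ) = 2 ^ K * (1 / 2) ^ K := by rw [← mul_pow]; norm_num
      _ ≤ _ := mul_le_mul_of_nonneg_left
          (pow_le_pow_of_le_one (by norm_num) (by norm_num) h.le) (by positivity)
  · rw [ind_false h]; positivity

lemma GoodCc_prob {p : ℝ} (hp0 : 0 ≤ p) (hp1 : p ≤ 1) (b0 c : Fin n)
    (zz : Fin N → Fin s → Fin n)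
    (hinj : ∀ τ i τ' i', zz τ i = zz τ' i' → τ = τ' ∧ i = i') (hb0 : ∀ τ i, zz τ i ≠ b0)
    (hc : ∀ τ i, zz τ i ≠ c) (A : Fin N → Finset (Fin s)) (K : ℕ) (hA : ∀ τ, K ≤ (A τ).card) :
    (1 - p) * (1 - (1 - p) ^ K) ^ N ≤ Pr p (GoodCc b0 zz A c) := by
  classical
  have hq0 : 0 ≤ 1 - p := by linarith
  have hq1 : 1 - p ≤ 1 := by linarith
  let ev : Option (Fin N) → (Sym2 (Fin n) → Bool) → Prop := fun o ω =>
    o.elim (ω s(c, b0) = false) (fun τ => ∃ i ∈ A τ, ω s(zz τ i, c) = true)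
  let S : Option (Fin N) → Set (Sym2 (Fin n)) := fun o =>
    o.elim {s(c, b0)} (fun τ => {e | ∃ i, e = s(zz τ i, c)})
  have h := Pr_forall_indep p (Finset.univ : Finset (Option (Fin N))) ev S ?_ ?_
  · have e1 : Pr p (GoodCc b0 zz A c) = Pr p (fun ω => ∀ o ∈ Finset.univ, ev o ω) := by
      refine Pr_congr fun ω => ?_
      simp [ev, GoodCc, Option.forall]
    rw [e1, h, Fintype.prod_option]
    have e2 : Pr p (ev none) = 1 - p := by
      have := Pr_all_false p ({s(c, b0)} : Finset (Sym2 (Fin n)))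
      simpa [ev] using this
    rw [e2]
    refine mul_le_mul_of_nonneg_left ?_ hq0
    have e3 : ∀ τ, Pr p (ev (some τ)) = 1 - (1 - p) ^ (A τ).card := by
      intro τ
      have := Pr_all_false p ((A τ).image fun i => s(zz τ i, c))
      rw [Finset.card_image_of_injective] at this
      · rw [← this, ← Pr_not]
        refine Pr_congr fun ω => ?_
        simp [ev]
      · intro i i' h
        exact (hinj τ i τ i' (Sym2.congr_left.mp h)).2
    calc (1 - (1 - p) ^ K) ^ N = ∏ τ : Fin N, (1 - (1 - p) ^ K) := by simp
      _ ≤ ∏ τ : Fin N, Pr p (ev (some τ)) := by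
        refine Finset.prod_le_prod (fun τ _ => ?_) (fun τ _ => ?_)
        · have := pow_le_one₀ (n := K) hq0 hq1
          linarith
        · rw [e3]
          have := pow_le_pow_of_le_one hq0 hq1 (hA τ)
          linarith
  · rintro (_ | τ) _ ω ω' h
    · have := h s(c, b0) rfl
      simp only [ev, Option.elim]
      rw [this]
    · refine propext (exists_congr fun i => and_congr_right fun _ => ?_)
      rw [h s(zz τ i, c) ⟨i, rfl⟩]
  · rintro (_ | τ) _ (_ | τ') _ hne
    · exact absurd rfl hne
    · rw [Set.disjoint_left]
      rintro e he ⟨i, hi⟩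
      have he : e = s(c, b0) := he
      rw [he, Sym2.eq_iff] at hi
      rcases hi with ⟨h1, _⟩ | ⟨_, h1⟩
      · exact hc τ' i h1.symm
      · exact hb0 τ' i h1.symm
    · rw [Set.disjoint_left]
      rintro e ⟨i, hi⟩ he
      have he : e = s(c, b0) := he
      rw [he, Sym2.eq_iff] at hi
      rcases hi with ⟨h1, _⟩ | ⟨_, h1⟩
      · exact hc τ i h1.symm
      · exact hb0 τ i h1.symm
    · rw [Set.disjoint_left]
      rintro e ⟨i, hi⟩ ⟨i', hi'⟩
      rw [hi] at hi'
      exact hne (congrArg some (hinj _ _ _ _ (Sym2.congr_left.mp hi')).1)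

/-- There is a suitable dominating vertex. -/
def ExistGood (R : Finset (Fin n)) (F : Fin N → Finset (Fin n)) (b : Fin N → Fin n) (b0 : Fin n)
    (ω : Sym2 (Fin n) → Bool) : Prop :=
  ∃ c, c ∉ R ∧ ¬ (gr ω).Adj c b0 ∧ ∀ τ, ∃ z, z ∉ R ∧ (gr ω).Adj z c ∧
    (∀ w ∈ F τ, (gr ω).Adj z w) ∧ ¬ (gr ω).Adj z (b τ)

lemma exist_bound {p : ℝ} (hp0 : 0 ≤ p) (hp1 : p ≤ 1) (R : Finset (Fin n))
    (F : Fin N → Finset (Fin n)) (b : Fin N → Fin n) (b0 : Fin n)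
    (hF : ∀ τ, F τ ⊆ R) (hbR : ∀ τ, b τ ∈ R) (hb : ∀ τ, b τ ∉ F τ) (hb0 : b0 ∈ R)
    (f : ℕ) (hf : ∀ τ, (F τ).card = f) (K : ℕ) (hs : (N + 1) * s ≤ n - R.card) :
    Pr p (fun ω => ¬ ExistGood R F b b0 ω) ≤
      N * (2 ^ K * (1 - p ^ f * (1 - p) / 2) ^ s) +
      (1 - (1 - p) * (1 - (1 - p) ^ K) ^ N) ^ s := by
  classical
  have hq0 : 0 ≤ 1 - p := by linarith
  have hq1 : 1 - p ≤ 1 := by linarith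
  obtain ⟨em⟩ : Nonempty ((Option (Fin N) × Fin s) ↪ {x : Fin n // x ∉ R}) := by
    apply Function.Embedding.nonempty_of_card_le
    rw [Fintype.card_prod, Fintype.card_option, Fintype.card_fin, Fintype.card_fin,
      Fintype.card_subtype_compl, Fintype.card_fin, Fintype.card_coe]
    exact hs
  let zz : Fin N → Fin s → Fin n := fun τ i => (em (some τ, i)).1
  let cc : Fin s → Fin n := fun k => (em (none, k)).1
  have hzz : ∀ τ i τ' i', zz τ i = zz τ' i' → τ = τ' ∧ i = i' := by
    intro τ i τ' i' h
    have := em.injective (Subtype.ext h)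
    simpa using this
  have hcc : Function.Injective cc := by
    intro k k' h
    have := em.injective (Subtype.ext h)
    simpa using this
  have hzc : ∀ τ i k, zz τ i ≠ cc k := by
    intro τ i k h
    have := em.injective (Subtype.ext h)
    simp at this
  have hzR : ∀ τ i, zz τ i ∉ R := fun τ i => (em (some τ, i)).2
  have hcR : ∀ k, cc k ∉ R := fun k => (em (none, k)).2
  set β := (1 - (1 - p) * (1 - (1 - p) ^ K) ^ N) ^ s with hβ
  -- reduction
  have step : Pr p (fun ω => ¬ ExistGood R F b b0 ω) ≤
      Pr p (fun ω => (∃ τ ∈ (Finset.univ : Finset (Fin N)), (goodSet F b zz ω τ).card < K) ∨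
        ((∀ τ, K ≤ (goodSet F b zz ω τ).card) ∧
          ∀ k ∈ (Finset.univ : Finset (Fin s)), ¬ GoodCc b0 zz (goodSet F b zz ω) (cc k) ω)) := by
    refine Pr_mono hp0 hp1 fun ω h => ?_
    by_cases h1 : ∃ τ ∈ (Finset.univ : Finset (Fin N)), (goodSet F b zz ω τ).card < K
    · exact Or.inl h1
    right
    push Not at h1
    refine ⟨fun τ => h1 τ (Finset.mem_univ _), fun k _ hg => h ?_⟩
    refine ⟨cc k, hcR k, ?_, fun τ => ?_⟩
    · rw [gr_adj, hg.1]; simp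
    · obtain ⟨i, hi, hbit⟩ := hg.2 τ
      rw [goodSet, Finset.mem_filter] at hi
      refine ⟨zz τ i, hzR τ i, (gr_adj _ _ _).mpr ⟨hbit, hzc τ i k⟩, fun w hw => ?_, ?_⟩
      · refine (gr_adj _ _ _).mpr ⟨hi.2.1 w hw, ?_⟩
        rintro e
        exact hzR τ i (e ▸ hF τ hw)
      · rw [gr_adj, hi.2.2]; simp
  refine step.trans ((Pr_or_le hp0 hp1 _ _).trans (add_le_add ?_ ?_))
  · refine (Pr_exists_le hp0 hp1 _ _).trans ?_
    have : ∀ τ ∈ (Finset.univ : Finset (Fin N)), Pr p (fun ω => (goodSet F b zz ω τ).card < K) ≤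
        2 ^ K * (1 - p ^ f * (1 - p) / 2) ^ s := by
      intro τ _
      have := small_set_prob hp0 hp1 R (F τ) (b τ) (hF τ) (hbR τ) (hb τ) (zz τ)
        (fun i i' h => (hzz _ _ _ _ h).2) (hzR τ) K
      rw [hf τ] at this
      exact this
    refine (Finset.sum_le_sum this).trans ?_
    simp
  · -- conditioning on the good set
    have hbad : ∀ A0 : Fin N → Finset (Fin s), (∀ τ, K ≤ (A0 τ).card) →
        Pr p (fun ω => ∀ k ∈ (Finset.univ : Finset (Fin s)), ¬ GoodCc b0 zz A0 (cc k) ω) ≤ β := by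
      intro A0 hA0
      rw [Pr_forall_indep p _ _ (fun k => {e | cc k ∈ e ∧ ∀ k', k' ≠ k → cc k' ∉ e})]
      · calc _ ≤ ∏ k : Fin s, (1 - (1 - p) * (1 - (1 - p) ^ K) ^ N) := by
              refine Finset.prod_le_prod (fun k _ => Pr_nonneg hp0 hp1 _) (fun k _ => ?_)
              rw [Pr_not]
              have := GoodCc_prob hp0 hp1 b0 (cc k) zz hzz
                (fun τ i e => hzR τ i (e ▸ hb0)) (fun τ i => hzc τ i k) A0 K hA0
              linarith
          _ = β := by simp [hβ]
      · intro k _ ω ω' h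
        have h1 : ω s(cc k, b0) = ω' s(cc k, b0) := by
          refine h _ ⟨by simp, fun k' hk' hm => ?_⟩
          rw [Sym2.mem_iff] at hm
          rcases hm with e | e
          · exact hk' (hcc e)
          · exact hcR k' (e ▸ hb0)
        have h2 : ∀ τ i, ω s(zz τ i, cc k) = ω' s(zz τ i, cc k) := by
          intro τ i
          refine h _ ⟨by simp, fun k' hk' hm => ?_⟩
          rw [Sym2.mem_iff] at hm
          rcases hm with e | e
          · exact hzc τ i k' e.symm
          · exact hk' (hcc e)
        simp only [GoodCc, h1, h2]
      · intro k _ k' _ hne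
        rw [Set.disjoint_left]
        rintro e ⟨h1, _⟩ ⟨_, h2⟩
        exact h2 k hne h1
    have hsplit : ∀ ω, ind ((∀ τ, K ≤ (goodSet F b zz ω τ).card) ∧
          ∀ k ∈ (Finset.univ : Finset (Fin s)), ¬ GoodCc b0 zz (goodSet F b zz ω) (cc k) ω) =
        ∑ A0 : Fin N → Finset (Fin s), ind (∀ τ, K ≤ (A0 τ).card) *
          (ind (goodSet F b zz ω = A0) *
          ind (∀ k ∈ (Finset.univ : Finset (Fin s)), ¬ GoodCc b0 zz A0 (cc k) ω)) := by
      intro ω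
      rw [Finset.sum_eq_single (goodSet F b zz ω)]
      · rw [ind_true (A := goodSet F b zz ω = goodSet F b zz ω) rfl, one_mul, ind_and]
      · intro A0 _ hA0
        rw [ind_false (A := goodSet F b zz ω = A0) (Ne.symm hA0)]
        ring
      · simp
    have hsum : Pr p (fun ω => (∀ τ, K ≤ (goodSet F b zz ω τ).card) ∧
          ∀ k ∈ (Finset.univ : Finset (Fin s)), ¬ GoodCc b0 zz (goodSet F b zz ω) (cc k) ω) =
        ∑ A0 : Fin N → Finset (Fin s), ind (∀ τ, K ≤ (A0 τ).card) *
          (Pr p (fun ω => goodSet F b zz ω = A0) *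
          Pr p (fun ω => ∀ k ∈ (Finset.univ : Finset (Fin s)), ¬ GoodCc b0 zz A0 (cc k) ω)) := by
      rw [Pr]
      simp only [hsplit]
      rw [Ex_sum]
      refine Finset.sum_congr rfl fun A0 _ => ?_
      rw [Ex_const_mul]
      congr 1
      refine Ex_indep p {e | ∀ k, cc k ∉ e} (dependsOn_ind ?_) (dependsOn_ind ?_)
      · intro ω ω' h
        have hbit : ∀ τ i, ∀ w ∈ R, ω s(zz τ i, w) = ω' s(zz τ i, w) := by
          intro τ i w hw
          refine h _ fun k hm => ?_
          rw [Sym2.mem_iff] at hm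
          rcases hm with e | e
          · exact hzc τ i k e.symm
          · exact hcR k (e ▸ hw)
        have : goodSet F b zz ω = goodSet F b zz ω' := by
          funext τ
          refine Finset.filter_congr fun i _ => ?_
          unfold GoodZ
          rw [hbit τ i _ (hbR τ)]
          exact and_congr_left fun _ => forall₂_congr fun w hw => by rw [hbit τ i w (hF τ hw)]
        simp only [this]
      · intro ω ω' h
        have h1 : ∀ k, ω s(cc k, b0) = ω' s(cc k, b0) := fun k =>
          h _ fun hm => hm k (by simp)
        have h2 : ∀ k τ i, ω s(zz τ i, cc k) = ω' s(zz τ i, cc k) := fun k τ i =>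
          h _ fun hm => hm k (by simp)
        simp only [GoodCc, h1, h2]
    rw [hsum]
    have hβ0 : 0 ≤ β := by
      rw [hβ]
      have h1 := pow_le_one₀ (n := K) hq0 hq1
      have h2 : 0 ≤ (1 - p) ^ K := by positivity
      have h3 : (1 - (1 - p) ^ K) ^ N ≤ 1 := pow_le_one₀ (by linarith) (by linarith)
      have h4 : 0 ≤ (1 - (1 - p) ^ K) ^ N := pow_nonneg (by linarith) _
      have : (1 - p) * (1 - (1 - p) ^ K) ^ N ≤ 1 * 1 := mul_le_mul hq1 h3 h4 (by norm_num)
      exact pow_nonneg (by linarith) _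
    calc _ ≤ ∑ A0 : Fin N → Finset (Fin s), Pr p (fun ω => goodSet F b zz ω = A0) * β := by
          refine Finset.sum_le_sum fun A0 _ => ?_
          have hP := Pr_nonneg hp0 hp1 (fun ω => goodSet F b zz ω = A0)
          by_cases h : ∀ τ, K ≤ (A0 τ).card
          · rw [ind_true h, one_mul]
            exact mul_le_mul_of_nonneg_left (hbad A0 h) hP
          · rw [ind_false h, zero_mul]
            positivity
      _ = β := by
          rw [← Finset.sum_mul]
          have : ∑ A0 : Fin N → Finset (Fin s), Pr p (fun ω => goodSet F b zz ω = A0) = 1 := by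
            unfold Pr
            rw [← Ex_sum]
            have : ∀ ω, ∑ A0 : Fin N → Finset (Fin s), ind (goodSet F b zz ω = A0) = 1 := by
              intro ω
              rw [Finset.sum_eq_single (goodSet F b zz ω)]
              · exact ind_true rfl
              · intro A0 _ hA0
                exact ind_false (Ne.symm hA0)
              · simp
            simp only [this]
            exact Ex_one p
          rw [this, one_mul]

end Exist2

end RandomGraphSpectra

namespace RandomGraphSpectra

/-! ### Part 6: the upper bound, combinatorial part -/

section Upper

variable {n : ℕ}

/-- the embedding is a copy of the pattern graph -/
def IsCopy (j : ℕ) {v : ℕ} (φ : Fin v → Fin n) (ω : Sym2 (Fin n) → Bool) : Prop :=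
  ∀ e ∈ edgeImg j φ, ω e = true

lemma isCopy_iff (j : ℕ) {v : ℕ} (φ : Fin v → Fin n) (ω : Sym2 (Fin n) → Bool) :
    IsCopy j φ ω ↔ ∀ x y : Fin v, HE j x y → ω s(φ x, φ y) = true := by
  constructor
  · intro h x y hxy
    exact h _ (Finset.mem_image.mpr ⟨(x, y), mem_EH.mpr hxy, rfl⟩)
  · intro h e he
    obtain ⟨⟨x, y⟩, hxy, rfl⟩ := Finset.mem_image.mp he
    exact h x y (mem_EH.mp hxy)

lemma isCopy_swap {j B : ℕ} (hj : 2 ≤ j) (hB : 1 ≤ B) (φ : Fin (B + 1) → Fin n)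
    (ω : Sym2 (Fin n) → Bool) (h : IsCopy j φ ω) :
    IsCopy j (φ ∘ Equiv.swap (0 : Fin (B + 1)) ⟨1, by omega⟩) ω := by
  rw [isCopy_iff] at h ⊢
  intro x y hxy
  have h1 : HE j (Equiv.swap (0 : Fin (B + 1)) ⟨1, by omega⟩ x)
      (Equiv.swap (0 : Fin (B + 1)) ⟨1, by omega⟩ y) ∨
      HE j (Equiv.swap (0 : Fin (B + 1)) ⟨1, by omega⟩ y)
      (Equiv.swap (0 : Fin (B + 1)) ⟨1, by omega⟩ x) := by
    have hz : ((0 : Fin (B + 1)) : ℕ) = 0 := rfl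
    simp only [HE, Equiv.swap_apply_def, Fin.ext_iff] at hxy ⊢
    obtain ⟨h1, h2⟩ := hxy
    split_ifs <;> simp only [hz] at * <;> omega
  rcases h1 with h1 | h1
  · exact h _ _ h1
  · have := h _ _ h1
    rw [Sym2.eq_swap] at this
    exact this

lemma copies_bound {j B : ℕ} (hj : 2 ≤ j) (hB : j ^ 2 ≤ B + 1) {x p : ℝ} (hx : 1 ≤ x)
    (hn : (n : ℝ) = x ^ (j * B)) (hp : p = (x ^ (B + 1))⁻¹) :
    Pr p (fun ω : Sym2 (Fin n) → Bool => ∃ φ ∈ Inj (B + 1) n, IsCopy j φ ω) ≤ 1 / 2 := by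
  classical
  have hp0 : 0 ≤ p := by rw [hp]; positivity
  have hp1 : p ≤ 1 := by
    rw [hp]; exact inv_le_one_of_one_le₀ (one_le_pow₀ hx)
  have hB1 : 1 ≤ B := by nlinarith
  have h1 : 2 * Pr p (fun ω : Sym2 (Fin n) → Bool => ∃ φ ∈ Inj (B + 1) n, IsCopy j φ ω) ≤
      ∑ φ ∈ Inj (B + 1) n, Pr p (fun ω : Sym2 (Fin n) → Bool => IsCopy j φ ω) := by
    simp only [Pr]
    rw [← Ex_const_mul, ← Ex_sum]
    refine Ex_mono hp0 hp1 fun ω => ?_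
    by_cases h : ∃ φ ∈ Inj (B + 1) n, IsCopy j φ ω
    · rw [ind_true h]
      obtain ⟨φ, hφ, hc⟩ := h
      have hinj : Function.Injective φ := by simpa [Inj] using hφ
      set φ' := φ ∘ Equiv.swap (0 : Fin (B + 1)) ⟨1, by omega⟩ with hφ'
      have hm : φ' ∈ Inj (B + 1) n := by
        simp only [Inj, Finset.mem_filter, Finset.mem_univ, true_and]
        exact hinj.comp (Equiv.injective _)
      have hne : φ ≠ φ' := by
        intro e
        have := congrFun e 0
        rw [hφ', Function.comp, Equiv.swap_apply_left] at this
        have := hinj this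
        simp [Fin.ext_iff] at this
      calc (2 : ℝ) * 1 = ∑ ψ ∈ ({φ, φ'} : Finset _), ind (IsCopy j ψ ω) := by
            rw [Finset.sum_pair hne, ind_true hc, ind_true (isCopy_swap hj hB1 φ ω hc)]
            norm_num
        _ ≤ _ := Finset.sum_le_sum_of_subset_of_nonneg (by
            intro a ha
            rcases Finset.mem_insert.mp ha with rfl | ha
            · exact hφ
            · rw [Finset.mem_singleton.mp ha]; exact hm) fun _ _ _ => ind_nonneg _
    · rw [ind_false h]
      simp only [mul_zero]
      exact Finset.sum_nonneg fun _ _ => ind_nonneg _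
  have h2 : ∑ φ ∈ Inj (B + 1) n, Pr p (fun ω : Sym2 (Fin n) → Bool => IsCopy j φ ω) =
      (Inj (B + 1) n).card * p ^ (j * B) := by
    rw [← nsmul_eq_mul]
    refine Finset.sum_eq_card_nsmul fun φ hφ => ?_
    have hinj : Function.Injective φ := by simpa [Inj] using hφ
    have := Pr_all_true p (edgeImg j φ)
    rw [edgeImg_card j φ hinj, EH_card' hj hB] at this
    exact this
  have h3 : ((Inj (B + 1) n).card : ℝ) ≤ (n : ℝ) ^ (B + 1) := by
    rw [Inj_card]
    exact_mod_cast Nat.descFactorial_le_pow n (B + 1)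
  have h4 := scale (e := j * B) rfl hx hn hp
  have h5 := mul_le_mul_of_nonneg_right h3 (pow_nonneg hp0 (j * B))
  linarith

/-- No good dominating vertex for the tuple. -/
def Bad (j : ℕ) {N : ℕ} (ψ : Fin (N + 1) → Fin n) (ω : Sym2 (Fin n) → Bool) : Prop :=
  ¬ ExistGood (Finset.univ.image ψ) (fun τ : Fin N => (Fidx j (N + 1) τ.succ).image ψ)
    (fun τ => if τ.val + 1 < j then ψ τ.succ else ψ 0) (ψ 0) ω

lemma Fidx_card {j N : ℕ} (hj : 2 ≤ j) (hN : j ≤ N + 1) (τ : Fin N) :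
    (Fidx j (N + 1) τ.succ).card = j - 1 := by
  unfold Fidx
  split_ifs with h
  · have : (Finset.univ.filter fun l : Fin (N + 1) => l.val < j ∧ l ≠ τ.succ) =
        (Finset.univ.filter fun l : Fin (N + 1) => l.val < j).erase τ.succ := by
      ext l
      simp only [Finset.mem_filter, Finset.mem_univ, true_and, Finset.mem_erase]
      tauto
    rw [this, Finset.card_erase_of_mem (by simpa using h), card_lt_eq j hN]
  · have : (Finset.univ.filter fun l : Fin (N + 1) => l = τ.succ ∨ (2 ≤ l.val ∧ l.val < j)) =
        insert τ.succ ((Finset.univ.filter fun l : Fin (N + 1) => l.val < j) \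
          (Finset.univ.filter fun l : Fin (N + 1) => l.val < 2)) := by
      ext l
      simp only [Finset.mem_filter, Finset.mem_univ, true_and, Finset.mem_insert,
        Finset.mem_sdiff, not_lt]
      tauto
    rw [this, Finset.card_insert_of_notMem (by simp at h ⊢; omega),
      Finset.card_sdiff_of_subset (by
        intro l
        simp only [Finset.mem_filter, Finset.mem_univ, true_and]
        omega), card_lt_eq j hN, card_lt_eq 2 (by omega)]
    omega

lemma bad_bound {j N s : ℕ} (hj : 2 ≤ j) (hN : j ≤ N + 1) {p : ℝ} (hp0 : 0 ≤ p) (hp1 : p ≤ 1)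
    (ψ : Fin (N + 1) → Fin n) (hψ : Function.Injective ψ) (K : ℕ)
    (hs : (N + 1) * s ≤ n - (N + 1)) :
    Pr p (Bad j ψ) ≤ N * (2 ^ K * (1 - p ^ (j - 1) * (1 - p) / 2) ^ s) +
      (1 - (1 - p) * (1 - (1 - p) ^ K) ^ N) ^ s := by
  classical
  refine exist_bound hp0 hp1 _ _ _ _ ?_ ?_ ?_ ?_ (j - 1) ?_ K ?_
  · intro τ
    exact Finset.image_subset_image (Finset.subset_univ _)
  · intro τ
    split_ifs <;> exact Finset.mem_image_of_mem _ (Finset.mem_univ _)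
  · intro τ
    split_ifs with h
    · rw [Finset.mem_image]
      rintro ⟨w, hw, e⟩
      rw [hψ e] at hw
      simp [Fidx, h] at hw
    · rw [Finset.mem_image]
      rintro ⟨w, hw, e⟩
      rw [hψ e] at hw
      simp [Fidx, h, Fin.ext_iff] at hw
  · exact Finset.mem_image_of_mem _ (Finset.mem_univ _)
  · intro τ
    rw [Finset.card_image_of_injective _ hψ, Fidx_card hj hN]
  · rw [Finset.card_image_of_injective _ hψ]
    simpa using hs

lemma enum_finset (S : Finset (Fin n)) :
    ∃ g : Fin S.card → Fin n, Function.Injective g ∧ ∀ y, y ∈ S ↔ ∃ i, g i = y := by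
  refine ⟨fun i => (S.equivFin.symm i : Fin n), ?_, ?_⟩
  · exact Subtype.val_injective.comp (Equiv.injective _)
  · intro y
    constructor
    · intro hy
      exact ⟨S.equivFin ⟨y, hy⟩, by simp⟩
    · rintro ⟨i, rfl⟩
      exact (S.equivFin.symm i).2

lemma LProp_cases {q B : ℕ} (hB : (q + 2) ^ 2 ≤ B + 1) (ω : Sym2 (Fin n) → Bool)
    (h : LProp q (gr ω)) :
    (∃ φ ∈ Inj (B + 1) n, IsCopy (q + 2) φ ω) ∨
      ∃ N ∈ Finset.Ico (q + 1) B, ∃ ψ ∈ Inj (N + 1) n, Bad (q + 2) ψ ω := by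
  classical
  obtain ⟨a, ⟨y, haa, hay, hyy⟩, hD⟩ := h
  have hainj : Function.Injective a := by
    intro i l e
    by_contra hne
    exact (haa i l hne).ne e
  have hyinj : Function.Injective y := by
    intro i l e
    by_contra hne
    exact (hyy i l hne).ne e
  set Nb : Finset (Fin n) := Finset.univ.filter fun v => ∀ i, (gr ω).Adj (a i) v with hNb
  have hmem : ∀ v, v ∈ Nb ↔ ∀ i, (gr ω).Adj (a i) v := by intro v; simp [hNb]
  have hB2 : 2 * (q + 2) ≤ B + 1 := by nlinarith
  by_cases hl : q + 2 + Nb.card ≤ B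
  · right
    obtain ⟨g, hg, hgm⟩ := enum_finset Nb
    have hgadj : ∀ i l, (gr ω).Adj (a i) (g l) := fun i l => (hmem _).1 ((hgm _).2 ⟨l, rfl⟩) i
    refine ⟨q + 1 + Nb.card, by simp; omega,
      fun x => if hx : x.val < q + 2 then a ⟨x.val, hx⟩ else g ⟨x.val - (q + 2), by omega⟩,
      ?_, ?_⟩
    · simp only [Inj, Finset.mem_filter, Finset.mem_univ, true_and]
      intro x x' e
      dsimp only at e
      split_ifs at e with h1 h2 h2
      · have := congrArg Fin.val (hainj e)
        exact Fin.ext this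
      · exact absurd e (hgadj _ _).ne
      · exact absurd e (hgadj _ _).ne'
      · have := congrArg Fin.val (hg e)
        simp only at this
        exact Fin.ext (by omega)
    · rintro ⟨c, hc, hc0, hz⟩
      set ψ : Fin (q + 1 + Nb.card + 1) → Fin n := fun x =>
        if hx : x.val < q + 2 then a ⟨x.val, hx⟩ else g ⟨x.val - (q + 2), by omega⟩ with hψ
      have hψa : ∀ l : Fin (q + 2), ψ ⟨l.val, by omega⟩ = a l := by
        intro l
        simp [hψ]
      have hψa' : ∀ l : Fin (q + 2), a l ∈ Finset.univ.image ψ := fun l => by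
        rw [← hψa l]; exact Finset.mem_image_of_mem _ (Finset.mem_univ _)
      have hψ0 : ψ 0 = a 0 := hψa 0
      apply hD
      refine ⟨c, ?_, ?_, ?_, ?_⟩
      · rintro l rfl
        exact hc (hψa' l)
      · rw [← hψ0]; exact hc0
      · intro i hi
        have hi0 : i.val ≠ 0 := fun e => hi (Fin.ext e)
        obtain ⟨z, h1, h2, h3, h4⟩ := hz ⟨i.val - 1, by omega⟩
        have hs : (⟨i.val - 1, by omega⟩ : Fin (q + 1 + Nb.card)).succ =
            ⟨i.val, by omega⟩ := Fin.ext (by simp; omega)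
        beta_reduce at h3 h4
        rw [if_pos (by simp only; omega), hs, hψa] at h4
        refine ⟨z, h2, ?_, h4, ?_⟩
        · intro l hl
          refine h3 _ ?_
          rw [← hψa l, hs]
          refine Finset.mem_image_of_mem _ ?_
          rw [Fidx, if_pos i.2]
          simp only [Finset.mem_filter, Finset.mem_univ, true_and]
          exact ⟨l.2, fun e => hl (Fin.ext (Fin.mk.inj_iff.mp e))⟩
        · rintro l rfl
          exact h1 (hψa' l)
      · intro v hv
        obtain ⟨i, rfl⟩ := (hgm v).1 ((hmem v).2 hv)
        obtain ⟨z, h1, h2, h3, h4⟩ := hz ⟨q + 1 + i.val, by omega⟩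
        have hs : (⟨q + 1 + i.val, by omega⟩ : Fin (q + 1 + Nb.card)).succ =
            ⟨q + 2 + i.val, by omega⟩ := Fin.ext (by simp; omega)
        have hψg : ψ ⟨q + 2 + i.val, by omega⟩ = g i := by
          simp [hψ]
        beta_reduce at h3 h4
        rw [if_neg (by simp only; omega), hψ0] at h4
        rw [hs, Fidx, if_neg (by simp only; omega)] at h3
        refine ⟨z, h2, ?_, ?_, h4, ?_⟩
        · refine h3 _ ?_
          rw [← hψg]
          exact Finset.mem_image_of_mem _ (by simp)
        · intro l hl0 hl1
          refine h3 _ ?_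
          rw [← hψa l]
          refine Finset.mem_image_of_mem _ ?_
          simp only [Finset.mem_filter, Finset.mem_univ, true_and]
          have e0 : l.val ≠ 0 := fun e => hl0 (Fin.ext e)
          have e1 : l.val ≠ 1 := fun e => hl1 (Fin.ext e)
          exact Or.inr ⟨by omega, l.2⟩
        · rintro l rfl
          exact h1 (hψa' l)
  · left
    set S := Nb \ Finset.univ.image y with hS
    have hyN : Finset.univ.image y ⊆ Nb := by
      intro v hv
      obtain ⟨l, -, rfl⟩ := Finset.mem_image.mp hv
      exact (hmem _).2 fun i => hay i l
    have hScard : B + 1 - 2 * (q + 2) ≤ S.card := by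
      rw [hS, Finset.card_sdiff_of_subset hyN, Finset.card_image_of_injective _ hyinj]
      simp only [Finset.card_univ, Fintype.card_fin]
      omega
    obtain ⟨g, hg, hgm⟩ := enum_finset S
    have hgS : ∀ i, g i ∈ S := fun i => (hgm _).2 ⟨i, rfl⟩
    have hgadj : ∀ i l, (gr ω).Adj (a i) (g l) := fun i l =>
      (hmem _).1 (Finset.mem_sdiff.mp (hgS l)).1 i
    have hgy : ∀ i l, g i ≠ y l := fun i l e =>
      (Finset.mem_sdiff.mp (hgS i)).2 (e ▸ Finset.mem_image_of_mem _ (Finset.mem_univ _))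
    refine ⟨fun x => if hx : x.val < q + 2 then a ⟨x.val, hx⟩ else
      if hx' : x.val < 2 * (q + 2) then y ⟨x.val - (q + 2), by omega⟩ else
      g ⟨x.val - 2 * (q + 2), by omega⟩, ?_, ?_⟩
    · simp only [Inj, Finset.mem_filter, Finset.mem_univ, true_and]
      intro x x' e
      dsimp only at e
      split_ifs at e with h1 h2 h3 h2 h3 h4 h5 h6
      · exact Fin.ext (congrArg Fin.val (hainj e) :)
      · exact absurd e (hay _ _).ne
      · exact absurd e (hgadj _ _).ne
      · exact absurd e (hay _ _).ne'
      · have := congrArg Fin.val (hyinj e)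
        simp only at this
        exact Fin.ext (by omega)
      · exact absurd e.symm (hgy _ _)
      · exact absurd e (hgadj _ _).ne'
      · exact absurd e (hgy _ _)
      · have := congrArg Fin.val (hg e)
        simp only at this
        exact Fin.ext (by omega)
    · rw [isCopy_iff]
      intro u v huv
      obtain ⟨h1, h2⟩ := huv
      suffices h : ∀ s t, (gr ω).Adj s t → ω s(s, t) = true by
        apply h
        split_ifs with c1 c2 c3 c4 c5 c6 c7 c8 c9
        · exact haa _ _ (fun e => by have := congrArg Fin.val e; simp only at this; omega)
        · exact hay _ _
        · exact hgadj _ _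
        · omega
        · exact hyy _ _ (fun e => by have := congrArg Fin.val e; simp only at this; omega)
        all_goals omega
      intro s t hst
      exact ((gr_adj ω s t).1 hst).1

end Upper

end RandomGraphSpectra

namespace RandomGraphSpectra

/-! ### Part 7: the upper bound, asymptotics -/

lemma term_one {q : ℝ} (hq1 : q ≤ 1) (K s : ℕ) (hK : (K : ℝ) ≤ s * q / 4) :
    2 ^ K * (1 - q / 2) ^ s ≤ Real.exp (-(s * q / 4)) := by
  have h1 : (2 : ℝ) ^ K ≤ Real.exp K := by
    have := Real.add_one_le_exp (1 : ℝ)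
    calc (2 : ℝ) ^ K ≤ (Real.exp 1) ^ K := pow_le_pow_left₀ (by norm_num) (by linarith) _
      _ = Real.exp K := by rw [← Real.exp_nat_mul]; simp
  have h2 : (1 - q / 2) ^ s ≤ Real.exp (-(s * q / 2)) := by
    calc (1 - q / 2) ^ s ≤ (Real.exp (-(q / 2))) ^ s :=
          pow_le_pow_left₀ (by linarith) (Real.one_sub_le_exp_neg _) _
      _ = _ := by rw [← Real.exp_nat_mul]; congr 1; ring
  calc 2 ^ K * (1 - q / 2) ^ s ≤ Real.exp K * Real.exp (-(s * q / 2)) :=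
        mul_le_mul h1 h2 (pow_nonneg (by linarith) _) (Real.exp_pos _).le
    _ = Real.exp (K + -(s * q / 2)) := (Real.exp_add _ _).symm
    _ ≤ _ := Real.exp_le_exp.mpr (by linarith)

lemma exp_neg_le_half {t : ℝ} (h0 : 0 ≤ t) (h1 : t ≤ 1) : Real.exp (-t) ≤ 1 - t / 2 := by
  rw [Real.exp_neg]
  have h2 := Real.add_one_le_exp t
  have h3 : 0 < Real.exp t := Real.exp_pos t
  rw [inv_le_iff_one_le_mul₀ h3]
  nlinarith

lemma term_two {p : ℝ} (hp0 : 0 ≤ p) (hp1 : p ≤ 1) (K N s : ℕ) (hK : p * K ≤ 1) :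
    (1 - (1 - p) * (1 - (1 - p) ^ K) ^ N) ^ s ≤
      Real.exp (-(s * ((1 - p) * (p * K / 2) ^ N))) := by
  have hpK : 0 ≤ p * K := by positivity
  have hq0 : 0 ≤ 1 - p := by linarith
  have hq1 : 1 - p ≤ 1 := by linarith
  have h1 : (1 - p) ^ K ≤ 1 - p * K / 2 := by
    calc (1 - p) ^ K ≤ (Real.exp (-p)) ^ K :=
          pow_le_pow_left₀ (by linarith) (Real.one_sub_le_exp_neg _) _
      _ = Real.exp (-(p * K)) := by rw [← Real.exp_nat_mul]; congr 1; ring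
      _ ≤ _ := exp_neg_le_half hpK hK
  have h0 : 0 ≤ (1 - p) ^ K := pow_nonneg hq0 _
  have h2 : (p * K / 2) ^ N ≤ (1 - (1 - p) ^ K) ^ N :=
    pow_le_pow_left₀ (by positivity) (by linarith) _
  have h3 : (1 - (1 - p) ^ K) ^ N ≤ 1 := pow_le_one₀ (by linarith) (by linarith)
  have h4 : 0 ≤ (1 - (1 - p) ^ K) ^ N := pow_nonneg (by linarith) _
  have h5 : (1 - p) * (p * K / 2) ^ N ≤ (1 - p) * (1 - (1 - p) ^ K) ^ N :=
    mul_le_mul_of_nonneg_left h2 hq0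
  have h6 : (1 - p) * (1 - (1 - p) ^ K) ^ N ≤ 1 := mul_le_one₀ hq1 h4 h3
  calc _ ≤ (1 - (1 - p) * (p * K / 2) ^ N) ^ s := pow_le_pow_left₀ (by linarith) (by linarith) _
    _ ≤ (Real.exp (-((1 - p) * (p * K / 2) ^ N))) ^ s :=
        pow_le_pow_left₀ (by linarith) (Real.one_sub_le_exp_neg _) _
    _ = _ := by rw [← Real.exp_nat_mul]; congr 1; ring

lemma bad_small {n j B N : ℕ} (hj : 2 ≤ j) (hjB : j ≤ B) (hN : j ≤ N + 1) (hNB : N + 1 ≤ B)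
    {x p : ℝ} (hx : 64 * ((B : ℝ) + 1) ≤ x)
    (hn : (n : ℝ) = x ^ (j * B)) (hp : p = (x ^ (B + 1))⁻¹)
    (ψ : Fin (N + 1) → Fin n) (hψ : Function.Injective ψ) :
    Pr p (Bad j ψ) ≤ B * Real.exp
      (-(1 / (8 * ((B : ℝ) + 1) * (128 * ((B : ℝ) + 1)) ^ B) * x)) := by
  have hB0 : (0 : ℝ) ≤ B := Nat.cast_nonneg _
  have hx1 : 1 ≤ x := by linarith
  have hx0 : 0 < x := by linarith
  have hp0 : 0 < p := by rw [hp]; positivity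
  have hxn : x ≤ n := by
    rw [hn]; exact le_self_pow₀ hx1 (Nat.mul_ne_zero (by omega) (by omega))
  have hpx : p ≤ 1 / 2 := by
    have h1 : (2 : ℝ) ≤ x ^ (B + 1) := by
      have : x ≤ x ^ (B + 1) := le_self_pow₀ hx1 (by positivity)
      linarith
    rw [hp, one_div]
    exact inv_anti₀ (by norm_num) h1
  have hn4 : 4 * (B + 1) ≤ n := by
    have : ((4 * (B + 1) : ℕ) : ℝ) ≤ n := by push_cast; linarith
    exact_mod_cast this
  set s := n / (2 * (B + 1)) with hs
  have hs1 : s * (2 * (B + 1)) ≤ n := Nat.div_mul_le_self _ _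
  have hs2 : n < (s + 1) * (2 * (B + 1)) := by
    have := Nat.lt_mul_div_succ n (show 0 < 2 * (B + 1) by omega)
    rw [mul_comm] at this
    exact this
  have hs3 : (n : ℝ) / (4 * (B + 1)) ≤ s := by
    rw [div_le_iff₀ (by positivity)]
    have : n ≤ s * (4 * (B + 1)) := by nlinarith
    exact_mod_cast this
  have hs4 : (s : ℝ) ≤ n := by exact_mod_cast Nat.div_le_self _ _
  have hsN : (N + 1) * s ≤ n - (N + 1) := by
    have h1 : (N + 1) * s ≤ (B + 1) * s := Nat.mul_le_mul_right _ (by omega)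
    have h2 : (B + 1) * s * 2 ≤ n := by linarith
    omega
  set qh := p ^ (j - 1) * (1 - p) with hqh
  have hpj1 : p ^ (j - 1) ≤ 1 := pow_le_one₀ hp0.le (by linarith)
  have hpj0 : 0 < p ^ (j - 1) := by positivity
  have hq0 : 0 < qh := mul_pos hpj0 (by linarith)
  have hq1 : qh ≤ p ^ (j - 1) := mul_le_of_le_one_right hpj0.le (by linarith)
  have hq2 : p ^ (j - 1) / 2 ≤ qh := by rw [hqh]; nlinarith
  have hnp : (n : ℝ) * p ^ (j - 1) = x ^ (B - j + 1) := by
    rw [hn, hp, inv_pow, ← pow_mul, mul_inv_eq_iff_eq_mul₀ (by positivity), ← pow_add]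
    congr 1
    obtain ⟨d, rfl⟩ := Nat.exists_eq_add_of_le hjB
    obtain ⟨i, rfl⟩ := Nat.exists_eq_add_of_le hj
    rw [show 2 + i - 1 = i + 1 by omega, show 2 + i + d - (2 + i) = d by omega]
    ring
  have hnpj : (n : ℝ) * p ^ j = (x ^ j)⁻¹ := by
    rw [hn, hp, inv_pow, ← pow_mul, mul_inv_eq_iff_eq_mul₀ (by positivity), eq_inv_mul_iff_mul_eq₀ (by positivity), ← pow_add]
    congr 1
    ring
  have hpp : p * p ^ (j - 1) = p ^ j := by
    rw [← pow_succ']; congr 1; omega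
  have hxj : x ≤ x ^ j := le_self_pow₀ hx1 (by omega)
  have hxB : x ≤ x ^ (B - j + 1) := le_self_pow₀ hx1 (by omega)
  have hsq : x ^ (B - j + 1) / (8 * ((B : ℝ) + 1)) ≤ s * qh := by
    calc x ^ (B - j + 1) / (8 * ((B : ℝ) + 1)) = (n / (4 * (B + 1))) * (p ^ (j - 1) / 2) := by
          rw [← hnp]; field_simp; ring
      _ ≤ s * qh := mul_le_mul hs3 hq2 (by positivity) (by positivity)
  have hsq' : x / (8 * ((B : ℝ) + 1)) ≤ s * qh :=
    (div_le_div_of_nonneg_right hxB (by positivity)).trans hsq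
  have hsq8 : 8 ≤ s * qh := by
    refine le_trans ?_ hsq'
    rw [le_div_iff₀ (by positivity)]
    linarith
  set K := ⌊(s : ℝ) * qh / 4⌋₊ with hK
  have hK1 : (K : ℝ) ≤ s * qh / 4 := Nat.floor_le (by positivity)
  have hK2 : s * qh / 8 ≤ (K : ℝ) := by
    have := Nat.lt_floor_add_one ((s : ℝ) * qh / 4)
    linarith
  have hpK1 : p * K ≤ 1 := by
    have h1 : (s : ℝ) * qh ≤ n * p ^ (j - 1) := mul_le_mul hs4 hq1 hq0.le (by positivity)
    calc p * K ≤ p * (n * p ^ (j - 1)) :=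
          mul_le_mul_of_nonneg_left (by linarith [mul_nonneg (Nat.cast_nonneg (α := ℝ) n) hpj0.le]) hp0.le
      _ = n * p ^ j := by rw [← hpp]; ring
      _ ≤ 1 := by rw [hnpj]; exact inv_le_one_of_one_le₀ (by linarith)
  have hpK2 : (x ^ j)⁻¹ / (128 * ((B : ℝ) + 1)) ≤ p * K / 2 := by
    have h1 : (x ^ j)⁻¹ = p * x ^ (B - j + 1) := by
      rw [← hnpj, ← hnp, ← hpp]; ring
    have h2 : p * (x ^ (B - j + 1) / (8 * ((B : ℝ) + 1)) / 8) ≤ p * K :=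
      mul_le_mul_of_nonneg_left (by linarith) hp0.le
    rw [h1]
    calc _ = p * (x ^ (B - j + 1) / (8 * ((B : ℝ) + 1)) / 8) / 2 := by field_simp; ring
      _ ≤ _ := by linarith
  set D : ℝ := 128 * ((B : ℝ) + 1) with hD
  have hD1 : 1 ≤ D := by rw [hD]; linarith
  have hD0 : 0 < D := by linarith
  set c : ℝ := 1 / (8 * ((B : ℝ) + 1) * D ^ B) with hc
  have hDB : 1 ≤ D ^ B := one_le_pow₀ hD1
  have e1 : c * x ≤ s * qh / 4 := by
    have : c ≤ 1 / (8 * ((B : ℝ) + 1)) / 4 := by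
      rw [hc, div_div]
      refine one_div_le_one_div_of_le (by positivity) ?_
      have h1 : D ≤ D ^ B := le_self_pow₀ hD1 (by omega)
      have h2 : 4 ≤ D := by linarith
      exact mul_le_mul_of_nonneg_left (by linarith) (by positivity)
    calc c * x ≤ 1 / (8 * ((B : ℝ) + 1)) / 4 * x := mul_le_mul_of_nonneg_right this hx0.le
      _ = x / (8 * ((B : ℝ) + 1)) / 4 := by ring
      _ ≤ _ := by linarith
  have e2 : c * x ≤ s * ((1 - p) * (p * K / 2) ^ N) := by
    have hb0 : 0 ≤ (x ^ j)⁻¹ / D := by positivity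
    have hb1 : (x ^ j)⁻¹ / D ≤ 1 := div_le_one_of_le₀
      ((inv_le_one_of_one_le₀ (by linarith)).trans hD1) hD0.le
    have h1 : ((x ^ j)⁻¹ / D) ^ (B - 1) ≤ (p * K / 2) ^ N :=
      (pow_le_pow_of_le_one hb0 hb1 (by omega)).trans (pow_le_pow_left₀ hb0 hpK2 _)
    have h2 : (n : ℝ) / (4 * (B + 1)) * (1 / 2 * ((x ^ j)⁻¹ / D) ^ (B - 1)) ≤
        s * ((1 - p) * (p * K / 2) ^ N) := by
      refine mul_le_mul hs3 (mul_le_mul (by linarith) h1 (by positivity) (by linarith))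
        (by positivity) (by positivity)
    refine le_trans ?_ h2
    have h3 : (n : ℝ) = (x ^ j) ^ (B - 1) * x ^ j := by
      rw [hn, pow_mul, ← pow_succ]; congr 1; omega
    have h4 : (n : ℝ) / (4 * (B + 1)) * (1 / 2 * ((x ^ j)⁻¹ / D) ^ (B - 1)) =
        1 / (8 * ((B : ℝ) + 1) * D ^ (B - 1)) * x ^ j := by
      rw [h3, div_pow, inv_pow]
      have : (x ^ j) ^ (B - 1) ≠ 0 := by positivity
      generalize (x ^ j) ^ (B - 1) = w at *
      field_simp
      ring
    rw [h4]
    refine mul_le_mul ?_ hxj hx0.le (by positivity)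
    rw [hc]
    refine one_div_le_one_div_of_le (by positivity) ?_
    exact mul_le_mul_of_nonneg_left (pow_le_pow_right₀ hD1 (by omega)) (by positivity)
  have hb := bad_bound hj hN hp0.le (by linarith : p ≤ 1) ψ hψ K hsN
  have t1 := term_one (hq1.trans hpj1) K s hK1
  have t2 := term_two hp0.le (by linarith : p ≤ 1) K N s hpK1
  have t1' : 2 ^ K * (1 - qh / 2) ^ s ≤ Real.exp (-(c * x)) :=
    t1.trans (Real.exp_le_exp.mpr (by linarith))
  have t2' := t2.trans (Real.exp_le_exp.mpr (neg_le_neg e2))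
  have hNB' : (N : ℝ) + 1 ≤ B := by exact_mod_cast hNB
  calc Pr p (Bad j ψ) ≤ N * (2 ^ K * (1 - qh / 2) ^ s) +
      (1 - (1 - p) * (1 - (1 - p) ^ K) ^ N) ^ s := hb
    _ ≤ N * Real.exp (-(c * x)) + Real.exp (-(c * x)) :=
        add_le_add (mul_le_mul_of_nonneg_left t1' (Nat.cast_nonneg _)) t2'
    _ = (N + 1) * Real.exp (-(c * x)) := by ring
    _ ≤ _ := mul_le_mul_of_nonneg_right hNB' (Real.exp_pos _).le

lemma upper_bound (q B : ℕ) (hB : (q + 2) ^ 2 ≤ B + 1) :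
    ∃ x0 : ℝ, ∀ (n : ℕ) (x p : ℝ), x0 ≤ x → (n : ℝ) = x ^ ((q + 2) * B) →
      p = (x ^ (B + 1))⁻¹ → Pr p (fun ω : Sym2 (Fin n) → Bool => LProp q (gr ω)) ≤ 3 / 4 := by
  classical
  set c : ℝ := 1 / (8 * ((B : ℝ) + 1) * (128 * ((B : ℝ) + 1)) ^ B) with hc
  have hc0 : 0 < c := by positivity
  have hlim : Tendsto (fun x : ℝ => (B : ℝ) ^ 2 * (x ^ ((q + 2) * B * B) * Real.exp (-(c * x))))
      atTop (𝓝 0) := by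
    have h1 := Real.tendsto_pow_mul_exp_neg_atTop_nhds_zero ((q + 2) * B * B)
    have h2 := h1.comp (tendsto_id.const_mul_atTop hc0)
    have h3 := h2.const_mul ((B : ℝ) ^ 2 / c ^ ((q + 2) * B * B))
    rw [mul_zero] at h3
    refine h3.congr fun x => ?_
    simp only [Function.comp, id]
    rw [mul_pow]
    have : c ^ ((q + 2) * B * B) ≠ 0 := by positivity
    field_simp
  have hev := hlim.eventually (eventually_le_nhds (b := (1 / 4 : ℝ)) (by norm_num))
  obtain ⟨x1, hx1⟩ := eventually_atTop.mp hev
  refine ⟨max x1 (64 * ((B : ℝ) + 1)), fun n x p hx hn hp => ?_⟩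
  have hxa : x1 ≤ x := (le_max_left _ _).trans hx
  have hxb : 64 * ((B : ℝ) + 1) ≤ x := (le_max_right _ _).trans hx
  have hB0 : (0 : ℝ) ≤ B := Nat.cast_nonneg _
  have hxone : 1 ≤ x := by linarith
  have hp0 : 0 ≤ p := by rw [hp]; positivity
  have hp1 : p ≤ 1 := by
    rw [hp]; exact inv_le_one_of_one_le₀ (one_le_pow₀ hxone)
  have hjB : q + 2 ≤ B := by nlinarith
  have hn1 : (1 : ℝ) ≤ n := by rw [hn]; exact one_le_pow₀ hxone
  have h1 := copies_bound (n := n) (j := q + 2) (by omega) hB hxone hn hp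
  have h2 : Pr p (fun ω : Sym2 (Fin n) → Bool =>
      ∃ N ∈ Finset.Ico (q + 1) B, ∃ ψ ∈ Inj (N + 1) n, Bad (q + 2) ψ ω) ≤ 1 / 4 := by
    have hNb : ∀ N ∈ Finset.Ico (q + 1) B, Pr p (fun ω : Sym2 (Fin n) → Bool =>
        ∃ ψ ∈ Inj (N + 1) n, Bad (q + 2) ψ ω) ≤ (n : ℝ) ^ B * (B * Real.exp (-(c * x))) := by
      intro N hN
      rw [Finset.mem_Ico] at hN
      calc _ ≤ ∑ ψ ∈ Inj (N + 1) n, Pr p (fun ω : Sym2 (Fin n) → Bool => Bad (q + 2) ψ ω) :=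
            Pr_exists_le hp0 hp1 _ _
        _ ≤ ∑ ψ ∈ Inj (N + 1) n, (B * Real.exp (-(c * x))) := by
            refine Finset.sum_le_sum fun ψ hψ => ?_
            exact bad_small (by omega) hjB (by omega) (by omega) hxb hn hp ψ
              (by simpa [Inj] using hψ)
        _ = ((Inj (N + 1) n).card : ℝ) * (B * Real.exp (-(c * x))) := by
            rw [Finset.sum_const, nsmul_eq_mul]
        _ ≤ _ := by
            refine mul_le_mul_of_nonneg_right ?_ (by positivity)
            rw [Inj_card]
            calc ((n.descFactorial (N + 1) : ℕ) : ℝ) ≤ (n : ℝ) ^ (N + 1) := by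
                  exact_mod_cast Nat.descFactorial_le_pow n (N + 1)
              _ ≤ _ := pow_le_pow_right₀ hn1 (by omega)
    calc _ ≤ ∑ N ∈ Finset.Ico (q + 1) B, Pr p (fun ω : Sym2 (Fin n) → Bool =>
        ∃ ψ ∈ Inj (N + 1) n, Bad (q + 2) ψ ω) := Pr_exists_le hp0 hp1 _ _
      _ ≤ ∑ N ∈ Finset.Ico (q + 1) B, (n : ℝ) ^ B * (B * Real.exp (-(c * x))) :=
          Finset.sum_le_sum hNb
      _ = ((B - (q + 1) : ℕ) : ℝ) * ((n : ℝ) ^ B * (B * Real.exp (-(c * x)))) := by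
          rw [Finset.sum_const, nsmul_eq_mul, Nat.card_Ico]
      _ ≤ (B : ℝ) * ((n : ℝ) ^ B * (B * Real.exp (-(c * x)))) := by
          refine mul_le_mul_of_nonneg_right ?_ (by positivity)
          exact_mod_cast Nat.sub_le _ _
      _ = (B : ℝ) ^ 2 * (x ^ ((q + 2) * B * B) * Real.exp (-(c * x))) := by
          rw [hn, ← pow_mul]; ring
      _ ≤ 1 / 4 := hx1 x hxa
  calc _ ≤ Pr p (fun ω : Sym2 (Fin n) → Bool =>
        (∃ φ ∈ Inj (B + 1) n, IsCopy (q + 2) φ ω) ∨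
        ∃ N ∈ Finset.Ico (q + 1) B, ∃ ψ ∈ Inj (N + 1) n, Bad (q + 2) ψ ω) :=
        Pr_mono hp0 hp1 fun ω h => LProp_cases hB ω h
    _ ≤ _ := Pr_or_le hp0 hp1 _ _
    _ ≤ 3 / 4 := by linarith

end RandomGraphSpectra

namespace RandomGraphSpectra

/-! ### Part 8: assembly -/

lemma alpha_mem (q B k : ℕ) (hB : (q + 2) ^ 2 ≤ B + 1) (hk : q + 2 + max (q + 2) 3 ≤ k) :
    ((B : ℝ) + 1) / (((q : ℝ) + 2) * B) ∈ S1 k := by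
  have hB3 : 3 ≤ B := by nlinarith
  have hB3' : (3 : ℝ) ≤ B := by exact_mod_cast hB3
  have hq0 : (0 : ℝ) ≤ q := Nat.cast_nonneg _
  set α : ℝ := ((B : ℝ) + 1) / (((q : ℝ) + 2) * B) with hα
  have hden : 0 < ((q : ℝ) + 2) * B := by positivity
  obtain ⟨φ, hφ, hsat⟩ := exists_sentence q
  refine ⟨⟨by positivity, ?_⟩, φ, hφ.trans hk, ?_⟩
  · rw [hα, div_lt_one hden]
    nlinarith
  obtain ⟨δ, hδ, hlow⟩ := lower_bound q B hB
  obtain ⟨x0, hup⟩ := upper_bound q B hB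
  have hxt : Tendsto (fun n : ℕ => (n : ℝ) ^ (1 / (((q : ℝ) + 2) * B))) atTop atTop :=
    (tendsto_rpow_atTop (by positivity)).comp tendsto_natCast_atTop_atTop
  have hmain : ∀ᶠ n : ℕ in atTop, δ ≤ probSat n ((n : ℝ) ^ (-α)) φ ∧
      probSat n ((n : ℝ) ^ (-α)) φ ≤ 3 / 4 := by
    filter_upwards [hlow, hxt.eventually (eventually_ge_atTop x0),
      hxt.eventually (eventually_ge_atTop 1)] with n h1 h2 h3
    have hn0 : (0 : ℝ) ≤ n := Nat.cast_nonneg n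
    have e1 : (n : ℝ) = ((n : ℝ) ^ (1 / (((q : ℝ) + 2) * B))) ^ ((q + 2) * B) := by
      rw [← Real.rpow_natCast, ← Real.rpow_mul hn0]
      push_cast
      rw [one_div_mul_cancel hden.ne', Real.rpow_one]
    have e2 : (n : ℝ) ^ (-α) = (((n : ℝ) ^ (1 / (((q : ℝ) + 2) * B))) ^ (B + 1))⁻¹ := by
      rw [← Real.rpow_natCast, ← Real.rpow_mul hn0, ← Real.rpow_neg hn0]
      congr 1
      push_cast
      rw [hα]
      ring
    have e3 : probSat n ((n : ℝ) ^ (-α)) φ =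
        Pr ((n : ℝ) ^ (-α)) (fun ω : Sym2 (Fin n) → Bool => LProp q (gr ω)) := by
      rw [probSat, probPred_eq]
      exact Pr_congr fun ω => hsat n (gr ω)
    rw [e3]
    exact ⟨h1 _ _ h3 e1 e2, hup n _ _ h2 e1 e2⟩
  rintro (h | h)
  · have := ge_of_tendsto h (hmain.mono fun n hn => hn.1)
    linarith
  · have := le_of_tendsto h (hmain.mono fun n hn => hn.2)
    linarith

lemma main_acc (k : ℕ) (hk : 5 ≤ k) :
    AccPt ((1 : ℝ) / ((k / 2 : ℕ) : ℝ)) (Filter.principal (S1 k)) := by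
  obtain ⟨q, hq⟩ : ∃ q, k / 2 = q + 2 := ⟨k / 2 - 2, by omega⟩
  rw [hq]
  push_cast
  have hq0 : (0 : ℝ) ≤ q := Nat.cast_nonneg _
  rw [accPt_iff_frequently]
  have ht : Tendsto (fun B : ℕ => ((B : ℝ) + 1) / (((q : ℝ) + 2) * B)) atTop
      (𝓝 (1 / ((q : ℝ) + 2))) := by
    have h1 : Tendsto (fun B : ℕ => (1 / ((q : ℝ) + 2)) * (1 + 1 / (B : ℝ))) atTop
        (𝓝 ((1 / ((q : ℝ) + 2)) * (1 + 0))) :=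
      (tendsto_const_nhds.add tendsto_one_div_atTop_nhds_zero_nat).const_mul _
    rw [add_zero, mul_one] at h1
    refine h1.congr' ?_
    filter_upwards [eventually_gt_atTop 0] with B hB
    have : (0 : ℝ) < B := by exact_mod_cast hB
    field_simp
  refine ht.frequently (Eventually.frequently ?_)
  filter_upwards [eventually_ge_atTop ((q + 2) ^ 2)] with B hB
  have hB1 : (0 : ℝ) < B := by
    have : 0 < B := lt_of_lt_of_le (by positivity) hB
    exact_mod_cast this
  refine ⟨?_, alpha_mem q B k (by omega) ?_⟩
  · intro e
    rw [div_eq_div_iff (by positivity) (by positivity)] at e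
    nlinarith
  · rcases max_cases (q + 2) 3 with ⟨h, _⟩ | ⟨h, _⟩ <;> omega

end RandomGraphSpectra

namespace RandomGraphSpectra

/-- For every integer `k ≥ 5`, the number `1/⌊k/2⌋` is a limit point of `S_k^1`. -/
theorem limit_point_one_div_half_k (k : ℕ) (hk : 5 ≤ k) :
    AccPt ((1 : ℝ) / ((k / 2 : ℕ) : ℝ)) (Filter.principal (S1 k)) := by
  exact main_acc k hk

end RandomGraphSpectra
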